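/- Let I ⊆ Π be μ-connected. Then: (1) ri(F_I) = W_I·(ri(F_I) ∩ C̄); (2) ri(F_I) ∩ C̄ = (μ − ℝ_>I) ∩ C̄; (3) (μ − ℝ_>I) ∩ C̄ is the union, over all subsets I_f ⊆ I each of whose connected components is of finite type, of the sets (μ − ℝ_>I) ∩ C_{I_* ∪ I_f}; these sets are pairwise disjoint and each of them is nonempty. -/

import Mathlib

open Set Module

noncomputable section

/-- The linear reflection `x ↦ x - f x • a` associated to a vector `a` and a linear
functional `f` with `f a = 2`, bundled as a linear automorphism. -/
def reflEquiv {V : Type*} [AddCommGroup V] [Module ℝ V]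
    (a : V) (f : V →ₗ[ℝ] ℝ) (h2 : f a = 2) : V ≃ₗ[ℝ] V :=
  LinearEquiv.ofInvolutive (LinearMap.id - f.smulRight a)
    (fun x => by
      simp only [LinearMap.sub_apply, LinearMap.id_apply, LinearMap.smulRight_apply,
        map_sub, map_smul, smul_eq_mul, h2]
      module)

/-- A realization over `ℝ` of an `m × m` generalized Cartan matrix `A`:
simple roots `α_i`, simple coroots `α_i∨` (as linear functionals), with
`⟨α_j, α_i∨⟩ = a_{ij}`, together with the defining axioms. -/
structure GCMRealization (m : ℕ) (V : Type*) [NormedAddCommGroup V] [NormedSpace ℝ V] where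
  A : Matrix (Fin m) (Fin m) ℤ
  root : Fin m → V
  coroot : Fin m → V →ₗ[ℝ] ℝ
  one_le_m : 1 ≤ m
  A_diag : ∀ i, A i i = 2
  A_offdiag : ∀ i j, i ≠ j → A i j ≤ 0
  A_zero_iff : ∀ i j, A i j = 0 ↔ A j i = 0
  root_indep : LinearIndependent ℝ root
  coroot_indep : LinearIndependent ℝ coroot
  pairing : ∀ i j, coroot i (root j) = (A i j : ℝ)
  finDim : FiniteDimensional ℝ V
  dim_eq : finrank ℝ V + (A.map ((↑) : ℤ → ℝ)).rank = 2 * m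

/-- A face of a convex set `H`: a convex subset `F ⊆ H` such that whenever the open
segment between two points of `H` meets `F`, both points lie in `F`. -/
def IsFaceOf {V : Type*} [NormedAddCommGroup V] [NormedSpace ℝ V] (H F : Set V) : Prop :=
  Convex ℝ F ∧ IsExtreme ℝ H F

namespace GCMRealization

variable {m : ℕ} {V : Type*} [NormedAddCommGroup V] [NormedSpace ℝ V]
variable (S : GCMRealization m V)

/-- The fundamental reflection `r_i`. -/
def s (i : Fin m) : V ≃ₗ[ℝ] V :=
  reflEquiv (S.root i) (S.coroot i) (by
    have h := S.pairing i i
    rw [S.A_diag i] at h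
    simpa using h)

/-- The Weyl group `W`, as a subgroup of the group of linear automorphisms of `V`. -/
def W : Subgroup (V ≃ₗ[ℝ] V) := Subgroup.closure (Set.range S.s)

/-- The standard parabolic subgroup `W_I` generated by the reflections indexed by `I`. -/
def WI (I : Set (Fin m)) : Subgroup (V ≃ₗ[ℝ] V) := Subgroup.closure (S.s '' I)

/-- The closed fundamental chamber `C̄`. -/
def chamber : Set V := {η | ∀ i, 0 ≤ S.coroot i η}

/-- `J₀`: the set of indices `i` with `⟨μ, α_i∨⟩ = 0`. -/
def J0 (μ : V) : Set (Fin m) := {i | S.coroot i μ = 0}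

/-- The orbit of `μ` under a subgroup of linear automorphisms. -/
def orbitOf (G : Subgroup (V ≃ₗ[ℝ] V)) (μ : V) : Set V :=
  (fun w : V ≃ₗ[ℝ] V => w μ) '' (G : Set (V ≃ₗ[ℝ] V))

/-- `F_I`: the convex hull of `W_I · μ`. -/
def face (μ : V) (I : Set (Fin m)) : Set V := convexHull ℝ (orbitOf (S.WI I) μ)

/-- `H`: the convex hull of the Weyl group orbit of `μ`. -/
def orbitHull (μ : V) : Set V := convexHull ℝ (orbitOf S.W μ)

/-- `ℝ₊I`: the set of nonnegative linear combinations of the simple roots indexed by `I`. -/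
def coneNonneg (I : Set (Fin m)) : Set V :=
  {v | ∃ c : Fin m → ℝ, (∀ i, 0 ≤ c i) ∧ (∀ i, i ∉ I → c i = 0) ∧ v = ∑ i, c i • S.root i}

/-- `ℝ_>I`: the set of strictly positive linear combinations of the simple roots indexed
by `I` (with `ℝ_>∅ = {0}`). -/
def conePos (I : Set (Fin m)) : Set V :=
  {v | ∃ c : Fin m → ℝ, (∀ i ∈ I, 0 < c i) ∧ (∀ i, i ∉ I → c i = 0) ∧ v = ∑ i, c i • S.root i}

/-- The open standard facet `C_J`. -/
def openFacet (J : Set (Fin m)) : Set V :=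
  {η | (∀ i ∈ J, S.coroot i η = 0) ∧ ∀ i, i ∉ J → 0 < S.coroot i η}

/-- The closed standard facet `C̄_J`. -/
def closedFacet (J : Set (Fin m)) : Set V :=
  {η | (∀ i ∈ J, S.coroot i η = 0) ∧ ∀ i, i ∉ J → 0 ≤ S.coroot i η}

/-- Adjacency of two vertices of the Dynkin diagram: `i ≠ j` and `a_{ij} ≠ 0`
(equivalently `a_{ji} ≠ 0`). -/
def Adjacent (i j : Fin m) : Prop := i ≠ j ∧ S.A i j ≠ 0 ∧ S.A j i ≠ 0

/-- The Dynkin diagram, as a simple graph on the index set. -/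
def diagram : SimpleGraph (Fin m) where
  Adj := S.Adjacent
  symm := ⟨fun _ _ h => ⟨h.1.symm, h.2.2, h.2.1⟩⟩
  loopless := ⟨fun _ h => h.1 rfl⟩

/-- A subset `I` is `μ`-connected if every connected component of `I` meets
`J_> = Π \ J₀` (the empty set is `μ`-connected). -/
def MuConnected (μ : V) (I : Set (Fin m)) : Prop :=
  ∀ i : I, ∃ j : I, S.coroot (j : Fin m) μ ≠ 0 ∧ (S.diagram.induce I).Reachable i j

/-- The connected component of `i` inside `K`, as a subset of the index set. -/
def comp (K : Set (Fin m)) (i : Fin m) : Set (Fin m) :=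
  {j | ∃ (hi : i ∈ K) (hj : j ∈ K), (S.diagram.induce K).Reachable ⟨i, hi⟩ ⟨j, hj⟩}

/-- `I*`: the largest `μ`-connected subset of `I`, i.e. the union of the connected
components of `I` that meet `J_>`. -/
def muPart (μ : V) (I : Set (Fin m)) : Set (Fin m) :=
  {j | ∃ (hj : j ∈ I) (k : Fin m) (hk : k ∈ I), S.coroot k μ ≠ 0 ∧
    (S.diagram.induce I).Reachable ⟨j, hj⟩ ⟨k, hk⟩}

/-- `I_*`: the set of `α ∈ J₀ \ I` orthogonal to all of `I`. -/
def starSet (μ : V) (I : Set (Fin m)) : Set (Fin m) :=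
  {i | S.coroot i μ = 0 ∧ i ∉ I ∧ ∀ j ∈ I, S.coroot i (S.root j) = 0}

/-- A subset `K ⊆ Π` is of finite type if the subgroup `W_K` is finite. -/
def FiniteType (K : Set (Fin m)) : Prop := ((S.WI K : Subgroup (V ≃ₗ[ℝ] V)) : Set (V ≃ₗ[ℝ] V)).Finite

/-- Every connected component of `K` is of finite type. -/
def FinTypeComponents (K : Set (Fin m)) : Prop := ∀ i ∈ K, S.FiniteType (S.comp K i)

/-- A fundamental face of `H`: a face which is empty or whose relative interior meets
the fundamental chamber. -/
def IsFundFace (μ : V) (F : Set V) : Prop :=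
  IsFaceOf (S.orbitHull μ) F ∧ (F = ∅ ∨ (intrinsicInterior ℝ F ∩ S.chamber).Nonempty)

/-- The length of `w ∈ W` with respect to the fundamental reflections. -/
def len (w : V ≃ₗ[ℝ] V) : ℕ :=
  sInf {k | ∃ l : List (Fin m), l.length = k ∧ w = (l.map S.s).prod}

end GCMRealization

end


set_option linter.unusedSimpArgs false

namespace GCMRealization

variable {m : ℕ} {V : Type*} [NormedAddCommGroup V] [NormedSpace ℝ V]
variable (S : GCMRealization m V)

theorem s_apply (i : Fin m) (x : V) : S.s i x = x - S.coroot i x • S.root i := rfl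

theorem coroot_root_self (i : Fin m) : S.coroot i (S.root i) = 2 := by
  rw [S.pairing, S.A_diag]; norm_num

theorem s_s_apply (i : Fin m) (x : V) : S.s i (S.s i x) = x := by
  simp only [s_apply, map_sub, map_smul, coroot_root_self]
  module

theorem s_mul_s (i : Fin m) : S.s i * S.s i = 1 := by
  ext x; exact S.s_s_apply i x

theorem mul_s_mul_s (w : V ≃ₗ[ℝ] V) (i : Fin m) : w * S.s i * S.s i = w := by
  rw [mul_assoc, s_mul_s, mul_one]

theorem s_mul_s_mul (w : V ≃ₗ[ℝ] V) (i : Fin m) : S.s i * (S.s i * w) = w := by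
  rw [← mul_assoc, s_mul_s, one_mul]

theorem s_inv (i : Fin m) : (S.s i)⁻¹ = S.s i := inv_eq_of_mul_eq_one_left (S.s_mul_s i)

/-- The product of the reflections along a word. -/
def wd (l : List (Fin m)) : V ≃ₗ[ℝ] V := (l.map S.s).prod

@[simp] theorem wd_nil : S.wd [] = 1 := rfl
@[simp] theorem wd_cons (i : Fin m) (l : List (Fin m)) : S.wd (i :: l) = S.s i * S.wd l := by
  simp [wd]
@[simp] theorem wd_append (l l' : List (Fin m)) : S.wd (l ++ l') = S.wd l * S.wd l' := by
  simp [wd]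

theorem s_mem_WI {I : Set (Fin m)} {i : Fin m} (hi : i ∈ I) : S.s i ∈ S.WI I :=
  Subgroup.subset_closure (mem_image_of_mem _ hi)

theorem wd_mem_WI {I : Set (Fin m)} (l : List (Fin m)) (h : ∀ k ∈ l, k ∈ I) : S.wd l ∈ S.WI I := by
  induction l with
  | nil => exact one_mem _
  | cons a l ih =>
    rw [wd_cons]
    exact mul_mem (S.s_mem_WI (h a (by simp))) (ih fun k hk => h k (by simp [hk]))

theorem wd_reverse (l : List (Fin m)) : S.wd l.reverse = (S.wd l)⁻¹ := by
  induction l with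
  | nil => simp
  | cons a l ih => simp [ih, s_inv]

theorem exists_word {I : Set (Fin m)} {w : V ≃ₗ[ℝ] V} (hw : w ∈ S.WI I) :
    ∃ l : List (Fin m), (∀ k ∈ l, k ∈ I) ∧ S.wd l = w := by
  induction hw using Subgroup.closure_induction with
  | mem x hx =>
    obtain ⟨i, hi, rfl⟩ := hx
    exact ⟨[i], by simpa using hi, by simp⟩
  | one => exact ⟨[], by simp, rfl⟩
  | mul x y _ _ hx hy =>
    obtain ⟨l, h, rfl⟩ := hx
    obtain ⟨l', h', rfl⟩ := hy
    refine ⟨l ++ l', ?_, by simp⟩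
    intro k hk
    rcases List.mem_append.1 hk with hk | hk
    · exact h k hk
    · exact h' k hk
  | inv x _ hx =>
    obtain ⟨l, h, rfl⟩ := hx
    refine ⟨l.reverse, by simpa using h, ?_⟩
    exact S.wd_reverse l

/-! ### Rank two -/

/-- Letters of the alternating word, counted from the right, starting with `j`. -/
def letter (i j : Fin m) (n : ℕ) : Fin m := if Even n then j else i

theorem letter_succ_ne (i j : Fin m) (n : ℕ) (k : Fin m) (hk : k = i ∨ k = j)
    (h : k ≠ letter i j (n + 1)) : k = letter i j n := by
  unfold letter at *
  by_cases hn : Even n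
  · have : ¬ Even (n + 1) := by simpa [Nat.even_add_one] using hn
    simp only [hn, this, if_true, if_false] at *
    tauto
  · have : Even (n + 1) := by simpa [Nat.even_add_one] using hn
    simp only [hn, this, if_true, if_false] at *
    tauto

/-- Alternating word of length `n` ending in `j`. -/
def altw (i j : Fin m) : ℕ → List (Fin m)
  | 0 => []
  | n + 1 => letter i j n :: altw i j n

theorem altw_length (i j : Fin m) (n : ℕ) : (altw i j n).length = n := by
  induction n with
  | zero => rfl
  | succ n ih => simp [altw, ih]

theorem letter_mem (i j : Fin m) (n : ℕ) : letter i j n = i ∨ letter i j n = j := by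
  unfold letter; split_ifs <;> simp

theorem altw_mem (i j : Fin m) (n : ℕ) : ∀ k ∈ altw i j n, k = i ∨ k = j := by
  induction n with
  | zero => simp [altw]
  | succ n ih =>
    intro k hk
    rcases List.mem_cons.1 hk with rfl | hk
    · exact letter_mem i j n
    · exact ih k hk

theorem rank2_words (i j : Fin m) (L : List (Fin m)) (hL : ∀ k ∈ L, k = i ∨ k = j) :
    (∃ L' : List (Fin m), (∀ k ∈ L', k = i ∨ k = j) ∧ L'.length < L.length ∧ S.wd L' = S.wd L) ∨
    (∃ L' : List (Fin m), (∀ k ∈ L', k = i ∨ k = j) ∧ L'.length < L.length ∧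
      S.wd L' = S.wd L * S.s i) ∨
    L = altw i j L.length := by
  induction L with
  | nil => right; right; rfl
  | cons a L ih =>
    have ha := hL a (by simp)
    rcases ih (fun k hk => hL k (by simp [hk])) with ⟨L', h1, h2, h3⟩ | ⟨L', h1, h2, h3⟩ | h
    · left
      refine ⟨a :: L', ?_, by simpa using h2, by simp [h3]⟩
      intro k hk
      rcases List.mem_cons.1 hk with rfl | hk
      · exact ha
      · exact h1 k hk
    · right; left
      refine ⟨a :: L', ?_, by simpa using h2, by simp [h3, mul_assoc]⟩
      intro k hk
      rcases List.mem_cons.1 hk with rfl | hk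
      · exact ha
      · exact h1 k hk
    · by_cases hal : a = letter i j L.length
      · right; right
        rw [List.length_cons, altw, ← h, hal]
      · cases hn : L.length with
        | zero =>
          have hL0 : L = [] := List.length_eq_zero_iff.1 hn
          subst hL0
          right; left
          refine ⟨[], by simp, by simp, ?_⟩
          have : a = i := by
            rcases ha with rfl | rfl
            · rfl
            · exact absurd (by simp [letter]) hal
          simp [this, s_mul_s]
        | succ n =>
          left
          rw [hn] at h hal
          have := letter_succ_ne i j n a ha hal
          refine ⟨altw i j n, altw_mem i j n, ?_, ?_⟩
          · simp [altw_length, hn]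
          · rw [h, altw, wd_cons, wd_cons, this, s_mul_s_mul]

theorem s_i_apply (i j : Fin m) (x : V) (p q : ℝ) :
    S.s i (x + p • S.root i + q • S.root j) =
      x + (-S.coroot i x - p - q * S.A i j) • S.root i + q • S.root j := by
  simp only [s_apply, map_add, map_smul, coroot_root_self, pairing]
  module

theorem s_j_apply (i j : Fin m) (x : V) (p q : ℝ) :
    S.s j (x + p • S.root i + q • S.root j) =
      x + p • S.root i + (-S.coroot j x - q - p * S.A j i) • S.root j := by
  simp only [s_apply, map_add, map_smul, coroot_root_self, pairing]
  module

theorem braid_step (i j : Fin m) (n : ℕ) (h : S.wd (altw i j (n + 1)) * S.s i = S.wd (altw i j n))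
    (N : ℕ) (hN : n < N) : ∃ L' : List (Fin m), (∀ k ∈ L', k = i ∨ k = j) ∧ L'.length < N ∧
      S.wd L' = S.wd (altw i j N) * S.s i := by
  induction N, hN using Nat.le_induction with
  | base => exact ⟨altw i j n, altw_mem i j n, by simp [altw_length], h.symm⟩
  | succ N hN ih =>
    obtain ⟨L', h1, h2, h3⟩ := ih
    refine ⟨letter i j N :: L', ?_, by simpa using h2, by simp [altw, h3, mul_assoc]⟩
    intro k hk
    rcases List.mem_cons.1 hk with rfl | hk
    · exact letter_mem i j N
    · exact h1 k hk

theorem letter_even (i j : Fin m) {n : ℕ} (h : Even n) : letter i j n = j := by simp [letter, h]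
theorem letter_odd (i j : Fin m) {n : ℕ} (h : ¬ Even n) : letter i j n = i := by simp [letter, h]

theorem s_comb_i (i j : Fin m) (p q : ℤ) :
    S.s i (p • S.root i + q • S.root j) = (-p - q * S.A i j) • S.root i + q • S.root j := by
  have := S.s_i_apply i j 0 p q
  simp only [zero_add, map_zero, neg_zero, zero_sub] at this
  have e : ∀ (z : ℤ) (v : V), z • v = (z : ℝ) • v := fun z v => (Int.cast_smul_eq_zsmul ℝ z v).symm
  rw [e p, e q, this]
  generalize S.A i j = z
  rw [e (-p - q * z)]; push_cast; rfl

theorem s_comb_j (i j : Fin m) (p q : ℤ) :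
    S.s j (p • S.root i + q • S.root j) = p • S.root i + (-q - p * S.A j i) • S.root j := by
  rw [add_comm, s_comb_i, add_comm]

theorem rank2_big (i j : Fin m) (a b : ℤ) (ha : S.A i j = -a) (hb : S.A j i = -b)
    (ha0 : 0 ≤ a) (hb0 : 0 ≤ b) (hab : 4 ≤ a * b) (n : ℕ) :
    ∃ p q : ℤ, 0 ≤ p ∧ 0 ≤ q ∧ S.wd (altw i j n) (S.root i) = p • S.root i + q • S.root j ∧
      (Even n → 2 * q ≤ b * p) ∧ (¬ Even n → 2 * p ≤ a * q) := by
  induction n with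
  | zero => exact ⟨1, 0, by simp, by simp, by simp [altw], by intro; simpa using hb0, by simp⟩
  | succ n ih =>
    obtain ⟨p, q, hp, hq, h, h1, h2⟩ := ih
    by_cases hn : Even n
    · have h1 := h1 hn
      refine ⟨p, b * p - q, hp, by linarith, ?_, ?_, ?_⟩
      · rw [altw, wd_cons, letter_even i j hn, LinearEquiv.mul_apply, h, s_comb_j, hb]
        congr 2; ring
      · intro h'; exact absurd hn (by simpa [Nat.even_add_one] using h')
      · intro _
        nlinarith [mul_le_mul_of_nonneg_left h1 ha0, mul_le_mul_of_nonneg_right hab hp]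
    · have h2 := h2 hn
      refine ⟨a * q - p, q, by linarith, hq, ?_, ?_, ?_⟩
      · rw [altw, wd_cons, letter_odd i j hn, LinearEquiv.mul_apply, h, s_comb_i, ha]
        congr 2; ring
      · intro _
        nlinarith [mul_le_mul_of_nonneg_left h2 hb0, mul_le_mul_of_nonneg_right hab hq]
      · intro h'; exact absurd (by simpa [Nat.even_add_one] using hn) h'


theorem rank2_small (i j : Fin m) (hij : i ≠ j) (n : ℕ) :
    (∃ L' : List (Fin m), (∀ k ∈ L', k = i ∨ k = j) ∧ L'.length < n ∧
      S.wd L' = S.wd (altw i j n) * S.s i) ∨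
    ∃ p q : ℕ, S.wd (altw i j n) (S.root i) = p • S.root i + q • S.root j := by
  obtain ⟨a, ha⟩ : ∃ a, S.A i j = -a := ⟨-S.A i j, by ring⟩
  obtain ⟨b, hb⟩ : ∃ b, S.A j i = -b := ⟨-S.A j i, by ring⟩
  have ha0 : 0 ≤ a := by have := S.A_offdiag i j hij; omega
  have hb0 : 0 ≤ b := by have := S.A_offdiag j i hij.symm; omega
  have hz : a = 0 ↔ b = 0 := by
    have := S.A_zero_iff i j
    rw [ha, hb] at this; simpa using this
  have key : ∀ p q : ℤ, 0 ≤ p → 0 ≤ q →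
      S.wd (altw i j n) (S.root i) = p • S.root i + q • S.root j →
      ∃ p q : ℕ, S.wd (altw i j n) (S.root i) = p • S.root i + q • S.root j := by
    intro p q hp hq h
    lift p to ℕ using hp
    lift q to ℕ using hq
    exact ⟨p, q, by simpa using h⟩
  have fin : ∀ N : ℕ, S.wd (altw i j (N + 1)) * S.s i = S.wd (altw i j N) →
      (∀ n ≤ N, ∃ p q : ℤ, 0 ≤ p ∧ 0 ≤ q ∧
        S.wd (altw i j n) (S.root i) = p • S.root i + q • S.root j) →
      (∃ L' : List (Fin m), (∀ k ∈ L', k = i ∨ k = j) ∧ L'.length < n ∧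
      S.wd L' = S.wd (altw i j n) * S.s i) ∨
      ∃ p q : ℕ, S.wd (altw i j n) (S.root i) = p • S.root i + q • S.root j := by
    intro N h1 h2
    by_cases hn : N < n
    · left; exact S.braid_step i j N h1 n hn
    · right
      obtain ⟨p, q, hp, hq, h⟩ := h2 n (not_lt.1 hn)
      exact key p q hp hq h
  have step : ∀ n p q, S.wd (altw i j n) (S.root i) = p • S.root i + q • S.root j →
      S.wd (altw i j (n + 1)) (S.root i) = (if Even n then p else a * q - p) • S.root i +
        (if Even n then b * p - q else q) • S.root j := by
    intro n p q h
    by_cases hn : Even n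
    · rw [altw, wd_cons, letter_even i j hn, LinearEquiv.mul_apply, h, s_comb_j, hb]
      simp only [hn, if_true]
      congr 2; ring
    · rw [altw, wd_cons, letter_odd i j hn, LinearEquiv.mul_apply, h, s_comb_i, ha]
      simp only [hn, if_false]
      congr 2; ring
  have c0 : S.wd (altw i j 0) (S.root i) = (1 : ℤ) • S.root i + (0 : ℤ) • S.root j := by
    simp [altw]
  have c1 := step _ _ _ c0
  have c2 := step _ _ _ c1
  have c3 := step _ _ _ c2
  have c4 := step _ _ _ c3
  have c5 := step _ _ _ c4
  have l0 : letter i j 0 = j := by simp [letter]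
  have l1 : letter i j 1 = i := by simp [letter]
  have l2 : letter i j 2 = j := by simp [letter]
  have l3 : letter i j 3 = i := by rw [letter_odd]; decide
  have l4 : letter i j 4 = j := by rw [letter_even]; decide
  have l5 : letter i j 5 = i := by rw [letter_odd]; decide
  have e1 : ¬ Even (0 + 1) := by decide
  have e2 : Even (0 + 1 + 1) := by decide
  have e3 : ¬ Even (0 + 1 + 1 + 1) := by decide
  have e4 : Even (0 + 1 + 1 + 1 + 1) := by decide
  simp only [e1, e2, e3, e4, Even.zero, if_true, if_false, zero_add, Nat.reduceAdd] at c1 c2 c3 c4 c5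
  have start : ∀ x : V, x = x + (0 : ℝ) • S.root i + (0 : ℝ) • S.root j := by intro x; simp
  by_cases hab : 4 ≤ a * b
  · right
    obtain ⟨p, q, hp, hq, h, -⟩ := S.rank2_big i j a b ha hb ha0 hb0 hab n
    exact key p q hp hq h
  have cases : (a = 0 ∧ b = 0) ∨ (a = 1 ∧ b = 1) ∨ (a = 1 ∧ b = 2) ∨ (a = 2 ∧ b = 1) ∨
      (a = 1 ∧ b = 3) ∨ (a = 3 ∧ b = 1) := by
    rcases eq_or_ne a 0 with h | h
    · left; exact ⟨h, hz.1 h⟩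
    · have hb1 : b ≠ 0 := fun h' => h (hz.2 h')
      have ha1 : 1 ≤ a := by omega
      have hb1 : 1 ≤ b := by omega
      have : a ≤ 3 := by nlinarith
      have : b ≤ 3 := by nlinarith
      clear key fin step c0 c1 c2 c3 c4 c5 ha hb hz
      interval_cases a <;> interval_cases b <;> omega
  rcases cases with ⟨rfl, rfl⟩ | ⟨rfl, rfl⟩ | ⟨rfl, rfl⟩ | ⟨rfl, rfl⟩ | ⟨rfl, rfl⟩ | ⟨rfl, rfl⟩
  · apply fin 1
    · ext x
      simp only [altw, wd_cons, wd_nil, l0, l1, l2, l3, l4, l5, mul_one, LinearEquiv.mul_apply]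
      rw [start x]
      simp only [s_i_apply, s_j_apply, ha, hb]
      push_cast
      module
    · intro n hn
      interval_cases n
      · exact ⟨_, _, by norm_num, by norm_num, c0⟩
      · exact ⟨_, _, by norm_num, by norm_num, c1⟩
  · apply fin 2
    · ext x
      simp only [altw, wd_cons, wd_nil, l0, l1, l2, l3, l4, l5, mul_one, LinearEquiv.mul_apply]
      rw [start x]
      simp only [s_i_apply, s_j_apply, ha, hb]
      push_cast
      module
    · intro n hn
      interval_cases n
      · exact ⟨_, _, by norm_num, by norm_num, c0⟩
      · exact ⟨_, _, by norm_num, by norm_num, c1⟩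
      · exact ⟨_, _, by norm_num, by norm_num, c2⟩
  all_goals first | (
    apply fin 3
    · ext x
      simp only [altw, wd_cons, wd_nil, l0, l1, l2, l3, l4, l5, mul_one, LinearEquiv.mul_apply]
      rw [start x]
      simp only [s_i_apply, s_j_apply, ha, hb]
      push_cast
      module
    · intro n hn
      interval_cases n
      · exact ⟨_, _, by norm_num, by norm_num, c0⟩
      · exact ⟨_, _, by norm_num, by norm_num, c1⟩
      · exact ⟨_, _, by norm_num, by norm_num, c2⟩
      · exact ⟨_, _, by norm_num, by norm_num, c3⟩) | (
    apply fin 5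
    · ext x
      simp only [altw, wd_cons, wd_nil, l0, l1, l2, l3, l4, l5, mul_one, LinearEquiv.mul_apply]
      rw [start x]
      simp only [s_i_apply, s_j_apply, ha, hb]
      push_cast
      module
    · intro n hn
      interval_cases n
      · exact ⟨_, _, by norm_num, by norm_num, c0⟩
      · exact ⟨_, _, by norm_num, by norm_num, c1⟩
      · exact ⟨_, _, by norm_num, by norm_num, c2⟩
      · exact ⟨_, _, by norm_num, by norm_num, c3⟩
      · exact ⟨_, _, by norm_num, by norm_num, c4⟩
      · exact ⟨_, _, by norm_num, by norm_num, c5⟩)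

/-! ### Positivity of roots -/

/-- `w` is a product of `n` reflections indexed by `I`. -/
def IsWord (I : Set (Fin m)) (n : ℕ) (w : V ≃ₗ[ℝ] V) : Prop :=
  ∃ l : List (Fin m), (∀ k ∈ l, k ∈ I) ∧ l.length = n ∧ S.wd l = w

/-- Nonnegative integral combinations of the simple roots in `I`. -/
def rootMonoid (I : Set (Fin m)) : AddSubmonoid V := AddSubmonoid.closure (S.root '' I)

theorem IsWord.mul {I : Set (Fin m)} {n n' : ℕ} {w w' : V ≃ₗ[ℝ] V} (h : S.IsWord I n w)
    (h' : S.IsWord I n' w') : S.IsWord I (n + n') (w * w') := by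
  obtain ⟨l, h1, h2, h3⟩ := h
  obtain ⟨l', h1', h2', h3'⟩ := h'
  refine ⟨l ++ l', ?_, by simp [h2, h2'], by simp [h3, h3']⟩
  intro k hk
  rcases List.mem_append.1 hk with hk | hk
  · exact h1 k hk
  · exact h1' k hk

theorem pair_mem {I : Set (Fin m)} {i j : Fin m} (hi : i ∈ I) (hj : j ∈ I) {L : List (Fin m)}
    (hL : ∀ k ∈ L, k = i ∨ k = j) : S.IsWord I L.length (S.wd L) := by
  refine ⟨L, ?_, rfl, rfl⟩
  intro k hk
  rcases hL k hk with rfl | rfl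
  · exact hi
  · exact hj

theorem root_pos (I : Set (Fin m)) (n : ℕ) : ∀ w : V ≃ₗ[ℝ] V, S.IsWord I n w →
    (∀ k < n, ¬ S.IsWord I k w) → ∀ i ∈ I, (∀ k < n, ¬ S.IsWord I k (w * S.s i)) →
    w (S.root i) ∈ S.rootMonoid I := by
  induction n using Nat.strong_induction_on with
  | _ n ih =>
  intro w hw hmin i hi hwi
  rcases Nat.eq_zero_or_pos n with rfl | hn
  · obtain ⟨l, -, h2, rfl⟩ := hw
    rw [List.length_eq_zero_iff.1 h2]
    exact AddSubmonoid.subset_closure (mem_image_of_mem _ hi)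
  obtain ⟨l, h1, h2, h3⟩ := hw
  rcases List.eq_nil_or_concat l with rfl | ⟨l0, j, rfl⟩
  · simp at h2; omega
  rw [List.concat_eq_append] at *
  have hj : j ∈ I := h1 j (by simp)
  have hw0 : S.IsWord I (n - 1) (w * S.s j) := by
    refine ⟨l0, fun k hk => h1 k (by simp [hk]), ?_, ?_⟩
    · simp at h2; omega
    · rw [← h3]; simp [mul_assoc, s_mul_s]
  have hij : i ≠ j := by
    rintro rfl
    exact hwi (n - 1) (by omega) hw0
  have hex : ∃ k : ℕ, ∃ (v : V ≃ₗ[ℝ] V) (L : List (Fin m)), S.IsWord I k v ∧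
      (∀ k ∈ L, k = i ∨ k = j) ∧ w = v * S.wd L ∧ k + L.length = n := by
    refine ⟨n - 1, w * S.s j, [j], hw0, by simp, ?_, by simp; omega⟩
    simp [mul_s_mul_s]
  classical
  have hle : Nat.find hex ≤ n - 1 := by
    refine Nat.find_min' hex ⟨w * S.s j, [j], hw0, by simp, ?_, by simp; omega⟩
    simp [mul_s_mul_s]
  obtain ⟨v, L, hv, hL, hwv, hlen⟩ := Nat.find_spec hex
  have hmin' := fun k (hk : k < Nat.find hex) => Nat.find_min hex hk
  set k := Nat.find hex with hk
  have hvmin : ∀ k' < k, ¬ S.IsWord I k' v := by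
    intro k' hk' h
    refine hmin (k' + L.length) (by omega) ?_
    rw [hwv]
    exact IsWord.mul S h (S.pair_mem hi hj hL)
  have hvs : ∀ a, a = i ∨ a = j → ∀ k' < k, ¬ S.IsWord I k' (v * S.s a) := by
    intro a ha k' hk' h
    have hL' : ∀ k ∈ a :: L, k = i ∨ k = j := by
      intro k hk
      rcases List.mem_cons.1 hk with rfl | hk
      · exact ha
      · exact hL k hk
    have hw' : w = (v * S.s a) * S.wd (a :: L) := by
      rw [hwv, wd_cons, mul_assoc, s_mul_s_mul]
    by_cases hkk : k' + 1 = k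
    · refine hmin' k' hk' ⟨v * S.s a, a :: L, h, hL', hw', by simp; omega⟩
    · refine hmin (k' + (a :: L).length) (by simp; omega) ?_
      rw [hw']
      exact IsWord.mul S h (S.pair_mem hi hj hL')
  have hvi : v (S.root i) ∈ S.rootMonoid I :=
    ih k (by omega) v hv hvmin i hi (hvs i (Or.inl rfl))
  have hvj : v (S.root j) ∈ S.rootMonoid I :=
    ih k (by omega) v hv hvmin j hj (hvs j (Or.inr rfl))
  have hbad : ∀ L' : List (Fin m), (∀ k ∈ L', k = i ∨ k = j) → L'.length < L.length →
      S.wd L' ≠ S.wd L * S.s i := by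
    intro L' h1 h2 h3
    refine hwi (k + L'.length) (by omega) ?_
    rw [hwv, mul_assoc, ← h3]
    exact IsWord.mul S hv (S.pair_mem hi hj h1)
  rcases S.rank2_words i j L hL with ⟨L', h1, h2, h3⟩ | ⟨L', h1, h2, h3⟩ | h
  · exfalso
    refine hmin (k + L'.length) (by omega) ?_
    rw [hwv, ← h3]
    exact IsWord.mul S hv (S.pair_mem hi hj h1)
  · exact absurd h3 (hbad L' h1 h2)
  · rcases S.rank2_small i j hij L.length with ⟨L', h1, h2, h3⟩ | ⟨p, q, h3⟩
    · rw [← h] at h3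
      exact absurd h3 (hbad L' h1 h2)
    · rw [← h] at h3
      rw [hwv, LinearEquiv.mul_apply, h3, map_add, map_nsmul, map_nsmul]
      exact add_mem (nsmul_mem hvi p) (nsmul_mem hvj q)

end GCMRealization

/-! ### M-matrix lemmas -/

theorem mmat_compare {K : Type*} [Fintype K] (B : K → K → ℝ)
    (hoff : ∀ i j, i ≠ j → B i j ≤ 0) (p d : K → ℝ) (hp : ∀ i, 0 < p i)
    (hBp : ∀ i, 0 < ∑ j, B i j * p j) (hBd : ∀ i, 0 < d i → ∑ j, B i j * d j ≤ 0) :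
    ∀ i, d i ≤ 0 := by
  by_contra! h
  obtain ⟨i0, hi0⟩ := h
  obtain ⟨i, -, hi⟩ := Finset.exists_max_image Finset.univ (fun i => d i / p i) ⟨i0, Finset.mem_univ _⟩
  have hi : ∀ j, d j / p j ≤ d i / p i := fun j => hi j (Finset.mem_univ _)
  set t := d i / p i with ht
  have htpos : 0 < t := lt_of_lt_of_le (div_pos hi0 (hp i0)) (hi i0)
  have hdi : d i = t * p i := by rw [ht]; field_simp [(hp i).ne']
  have hdipos : 0 < d i := by rw [hdi]; exact mul_pos htpos (hp i)
  have hsum : ∑ j, B i j * (t * p j - d j) ≤ 0 := by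
    apply Finset.sum_nonpos
    intro j _
    by_cases hij : i = j
    · subst hij; rw [hdi]; simp
    · apply mul_nonpos_of_nonpos_of_nonneg (hoff i j hij)
      have := (div_le_iff₀ (hp j)).1 (hi j)
      linarith
  have : ∑ j, B i j * (t * p j - d j) = t * ∑ j, B i j * p j - ∑ j, B i j * d j := by
    rw [Finset.mul_sum, ← Finset.sum_sub_distrib]
    exact Finset.sum_congr rfl fun j _ => by ring
  have h1 := mul_pos htpos (hBp i)
  have h2 := hBd i hdipos
  linarith

theorem mmat_inj {K : Type*} [Fintype K] (B : K → K → ℝ)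
    (hoff : ∀ i j, i ≠ j → B i j ≤ 0) (p d : K → ℝ) (hp : ∀ i, 0 < p i)
    (hBp : ∀ i, 0 < ∑ j, B i j * p j) (hBd : ∀ i, ∑ j, B i j * d j = 0) : d = 0 := by
  funext i
  have h1 := mmat_compare B hoff p d hp hBp (fun i _ => (hBd i).le) i
  have h2 := mmat_compare B hoff p (-d) hp hBp (fun i _ => by simp [hBd i]) i
  simp at h2 ⊢
  linarith

theorem mmat_surj {K : Type*} [Fintype K] (B : K → K → ℝ)
    (hoff : ∀ i j, i ≠ j → B i j ≤ 0) (p : K → ℝ) (hp : ∀ i, 0 < p i)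
    (hBp : ∀ i, 0 < ∑ j, B i j * p j) (g : K → ℝ) : ∃ d : K → ℝ, ∀ i, ∑ j, B i j * d j = g i := by
  have hinj : Function.Injective (Matrix.mulVecLin (Matrix.of B)) := by
    rw [← LinearMap.ker_eq_bot, LinearMap.ker_eq_bot']
    intro d hd
    exact mmat_inj B hoff p d hp hBp fun i => by
      have := congrFun hd i
      simpa [Matrix.mulVec, dotProduct] using this
  obtain ⟨d, hd⟩ := LinearMap.injective_iff_surjective.1 hinj g
  exact ⟨d, fun i => by
    have := congrFun hd i
    simpa [Matrix.mulVec, dotProduct] using this⟩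

theorem mmat_strict {K : Type*} [Fintype K] (B : K → K → ℝ)
    (hoff : ∀ i j, i ≠ j → B i j ≤ 0) (n : ℕ) : ∀ (p : K → ℝ), (∀ i, 0 < p i) →
    (∀ i, 0 ≤ ∑ j, B i j * p j) →
    (∀ Z : Set K, Z.Nonempty → (∀ i ∈ Z, ∀ j, B i j ≠ 0 → j ∈ Z) → ∃ i ∈ Z, 0 < ∑ j, B i j * p j) →
    {i | ∑ j, B i j * p j = 0}.ncard = n →
    ∃ p' : K → ℝ, (∀ i, 0 < p' i) ∧ ∀ i, 0 < ∑ j, B i j * p' j := by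
  classical
  induction n using Nat.strong_induction_on with
  | _ n ih =>
  intro p hp hBp hZ hn
  set Z := {i | ∑ j, B i j * p j = 0} with hZdef
  by_cases hne : Z.Nonempty
  swap
  · refine ⟨p, hp, fun i => lt_of_le_of_ne (hBp i) fun h => hne ⟨i, h.symm⟩⟩
  by_cases hcl : ∀ i ∈ Z, ∀ j, B i j ≠ 0 → j ∈ Z
  · obtain ⟨i, hi, hi'⟩ := hZ Z hne hcl
    exact absurd hi hi'.ne'
  push Not at hcl
  obtain ⟨i, hi, j, hij, hj⟩ := hcl
  have hj' : 0 < ∑ k, B j k * p k := lt_of_le_of_ne (hBp j) fun h => hj h.symm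
  have hne' : i ≠ j := by rintro rfl; exact hj hi
  obtain ⟨ε, hε, h1, h2⟩ : ∃ ε > 0, ε < p j ∧ ε * |B j j| < ∑ k, B j k * p k := by
    refine ⟨min (p j / 2) ((∑ k, B j k * p k) / (2 * (|B j j| + 1))), ?_, ?_, ?_⟩
    · have := hp j
      positivity
    · exact lt_of_le_of_lt (min_le_left _ _) (by linarith [hp j])
    · have hb : 0 < 2 * (|B j j| + 1) := by positivity
      have h := (le_div_iff₀ hb).1 (min_le_right (p j / 2) ((∑ k, B j k * p k) / (2 * (|B j j| + 1))))
      have h0 : 0 < min (p j / 2) ((∑ k, B j k * p k) / (2 * (|B j j| + 1))) := by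
        have := hp j
        positivity
      nlinarith [abs_nonneg (B j j)]
  have hsum : ∀ k, ∑ l, B k l * (p - Pi.single j ε : K → ℝ) l = (∑ l, B k l * p l) - B k j * ε := by
    intro k
    simp [mul_sub, Finset.sum_sub_distrib, Pi.single_apply]
  have hmono : ∀ k, 0 < ∑ l, B k l * p l → 0 < ∑ l, B k l * (p - Pi.single j ε : K → ℝ) l := by
    intro k hk
    rw [hsum]
    by_cases hkj : k = j
    · subst hkj
      have := le_abs_self (B k k)
      nlinarith
    · have := hoff k j hkj
      nlinarith
  have hnn : ∀ k, 0 ≤ ∑ l, B k l * (p - Pi.single j ε : K → ℝ) l := by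
    intro k
    rcases (hBp k).lt_or_eq with h | h
    · exact (hmono k h).le
    · rw [hsum]
      have hkj : k ≠ j := by rintro rfl; exact hj h.symm
      have := hoff k j hkj
      nlinarith
  refine ih _ ?_ (p - Pi.single j ε) ?_ hnn ?_ rfl
  · rw [← hn]
    apply Set.ncard_lt_ncard _ (Set.toFinite _)
    constructor
    · intro k hk
      by_contra hk'
      exact (hmono k (lt_of_le_of_ne (hBp k) fun h => hk' h.symm)).ne' hk
    · intro hsub
      have h := hsub hi
      rw [Set.mem_ofPred_eq, hsum] at h
      rw [hZdef, Set.mem_ofPred_eq] at hi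
      rw [hi, zero_sub, neg_eq_zero] at h
      exact (mul_ne_zero hij hε.ne') h
  · intro k
    by_cases hkj : k = j
    · subst hkj; simp; linarith
    · simp [hkj, hp k]
  · intro Y hY hY'
    obtain ⟨i, hi, hi'⟩ := hZ Y hY hY'
    exact ⟨i, hi, hmono i hi'⟩

theorem mmat_symm {K : Type*} [Fintype K] (B : K → K → ℝ)
    (hdiag : ∀ i, B i i = 2)
    (hoff : ∀ i j, i ≠ j → B i j ≤ 0) (hint : ∀ i j, i ≠ j → B i j ≠ 0 → B i j ≤ -1)
    (hz : ∀ i j, B i j = 0 ↔ B j i = 0)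
    (p : K → ℝ) (hp : ∀ i, 0 < p i) (hBp : ∀ i, 0 < ∑ j, B i j * p j) (n : ℕ) :
    ∀ J : Finset K, J.card = n →
    ∃ d : K → ℝ, (∀ i, 0 < d i) ∧ ∀ i ∈ J, ∀ j ∈ J, d i * B i j = d j * B j i := by
  classical
  induction n with
  | zero =>
    intro J hJ
    rw [Finset.card_eq_zero] at hJ
    subst hJ
    exact ⟨1, by simp, by simp⟩
  | succ n ih =>
    intro J hJ
    have hJne : J.Nonempty := by rw [← Finset.card_pos]; omega
    obtain ⟨i, hiJ, hi⟩ := Finset.exists_min_image J p hJne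
    obtain ⟨d, hd, hsym⟩ := ih (J.erase i) (by rw [Finset.card_erase_of_mem hiJ]; omega)
    -- at most one neighbour
    have huniq : ∀ j ∈ J, ∀ k ∈ J, j ≠ i → k ≠ i → B i j ≠ 0 → B i k ≠ 0 → j = k := by
      intro j hj k hk hji hki hbj hbk
      by_contra hjk
      have hle : ∑ l, B i l * p l ≤ ∑ l ∈ ({i, j, k} : Finset K), B i l * p l := by
        rw [← Finset.sum_add_sum_compl ({i, j, k} : Finset K)]
        have : ∑ l ∈ ({i, j, k} : Finset K)ᶜ, B i l * p l ≤ 0 := by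
          apply Finset.sum_nonpos
          intro l hl
          simp at hl
          exact mul_nonpos_of_nonpos_of_nonneg (hoff i l (Ne.symm hl.1)) (hp l).le
        linarith
      rw [Finset.sum_insert (by simp [hji.symm, hki.symm]), Finset.sum_insert (by simp [hjk]),
        Finset.sum_singleton, hdiag] at hle
      have h1 := hint i j hji.symm hbj
      have h2 := hint i k hki.symm hbk
      have h3 := hi j hj
      have h4 := hi k hk
      have h5 := hBp i
      nlinarith [hp i, hp j, hp k]
    by_cases hex : ∃ j ∈ J, j ≠ i ∧ B i j ≠ 0
    · obtain ⟨j, hj, hji, hbj⟩ := hex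
      have hb1 : B i j < 0 := by have := hint i j hji.symm hbj; linarith
      have hb2 : B j i < 0 := by
        have := hint j i hji (fun h => hbj ((hz j i).1 h)); linarith
      have key : ∀ l ∈ J, l ≠ i → (d j * B j i / B i j) * B i l = d l * B l i := by
        intro l hl hli
        by_cases hb : B i l = 0
        · rw [hb, (hz i l).1 hb]; simp
        · have := huniq j hj l hl hji hli hbj hb
          subst this
          field_simp
      refine ⟨Function.update d i (d j * B j i / B i j), ?_, ?_⟩
      · intro l
        by_cases hl : l = i
        · subst hl; simp only [Function.update_self]
          exact div_pos_of_neg_of_neg (mul_neg_of_pos_of_neg (hd j) hb2) hb1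
        · simp [hl, hd l]
      · intro k hk l hl
        by_cases hki : k = i <;> by_cases hli : l = i
        · rw [hki, hli]
        · subst hki; simp only [Function.update_self, Function.update_of_ne hli]
          exact key l hl hli
        · subst hli; simp only [Function.update_self, Function.update_of_ne hki]
          exact (key k hk hki).symm
        · simp only [Function.update_of_ne hki, Function.update_of_ne hli]
          exact hsym k (Finset.mem_erase.2 ⟨hki, hk⟩) l (Finset.mem_erase.2 ⟨hli, hl⟩)
    · push Not at hex
      refine ⟨d, hd, ?_⟩
      intro k hk l hl
      by_cases hki : k = i <;> by_cases hli : l = i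
      · rw [hki, hli]
      · subst hki
        rw [hex l hl hli, (hz k l).1 (hex l hl hli)]; simp
      · subst hli
        rw [hex k hk hki, (hz l k).1 (hex k hk hki)]; simp
      · exact hsym k (Finset.mem_erase.2 ⟨hki, hk⟩) l (Finset.mem_erase.2 ⟨hli, hl⟩)

theorem mmat_posdef {K : Type*} [Fintype K] (B : K → K → ℝ)
    (hoff : ∀ i j, i ≠ j → B i j ≤ 0)
    (p : K → ℝ) (hp : ∀ i, 0 < p i)
    (d : K → ℝ) (hd : ∀ i, 0 < d i) (hsym : ∀ i j, d i * B i j = d j * B j i) (x : K → ℝ) :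
    ∑ i, d i * (∑ j, B i j * p j) / p i * x i ^ 2 ≤ ∑ i, ∑ j, d i * B i j * x i * x j := by
  have e1 : ∑ i, d i * (∑ j, B i j * p j) / p i * x i ^ 2 =
      ∑ i, ∑ j, d i * B i j * p i * p j * (x i / p i) ^ 2 := by
    refine Finset.sum_congr rfl fun i _ => ?_
    rw [Finset.mul_sum, Finset.sum_div, Finset.sum_mul]
    refine Finset.sum_congr rfl fun j _ => ?_
    have := (hp i).ne'
    field_simp
  have e1' : ∑ i, ∑ j, d i * B i j * p i * p j * (x i / p i) ^ 2 =
      ∑ i, ∑ j, d i * B i j * p i * p j * (x j / p j) ^ 2 := by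
    rw [Finset.sum_comm]
    refine Finset.sum_congr rfl fun i _ => Finset.sum_congr rfl fun j _ => ?_
    rw [hsym j i]; ring
  have e2 : ∑ i, ∑ j, d i * B i j * x i * x j =
      ∑ i, ∑ j, d i * B i j * p i * p j * ((x i / p i) * (x j / p j)) := by
    refine Finset.sum_congr rfl fun i _ => Finset.sum_congr rfl fun j _ => ?_
    have := (hp i).ne'
    have := (hp j).ne'
    field_simp
  have e3 : ∑ i, ∑ j, d i * B i j * p i * p j * (x i / p i - x j / p j) ^ 2 ≤ 0 := by
    apply Finset.sum_nonpos; intro i _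
    apply Finset.sum_nonpos; intro j _
    by_cases hij : i = j
    · subst hij; simp
    · have h1 : d i * B i j * p i * p j = -(d i * -B i j * p i * p j) := by ring
      have h2 : 0 ≤ d i * -B i j * p i * p j := by
        have := hoff i j hij
        have h3 : 0 ≤ -B i j := by linarith
        have := (hd i).le; have := (hp i).le; have := (hp j).le
        positivity
      rw [h1, neg_mul]
      have := mul_nonneg h2 (sq_nonneg (x i / p i - x j / p j))
      linarith
  have e4 : ∑ i, ∑ j, d i * B i j * p i * p j * (x i / p i - x j / p j) ^ 2 =
      (∑ i, ∑ j, d i * B i j * p i * p j * (x i / p i) ^ 2) +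
      (∑ i, ∑ j, d i * B i j * p i * p j * (x j / p j) ^ 2) -
      2 * ∑ i, ∑ j, d i * B i j * p i * p j * ((x i / p i) * (x j / p j)) := by
    rw [Finset.mul_sum, ← Finset.sum_add_distrib, ← Finset.sum_sub_distrib]
    refine Finset.sum_congr rfl fun i _ => ?_
    rw [Finset.mul_sum, ← Finset.sum_add_distrib, ← Finset.sum_sub_distrib]
    refine Finset.sum_congr rfl fun j _ => ?_
    ring
  rw [e1, e2]
  linarith

theorem mmat_invariant {K : Type*} [Fintype K] [DecidableEq K] (B : K → K → ℝ)
    (hdiag : ∀ i, B i i = 2)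
    (d : K → ℝ) (hsym : ∀ i j, d i * B i j = d j * B j i) (x : K → ℝ) (k : K) :
    let y := x - Pi.single k (∑ j, B k j * x j)
    ∑ i, ∑ j, d i * B i j * y i * y j = ∑ i, ∑ j, d i * B i j * x i * x j := by
  intro y
  set t := ∑ j, B k j * x j with ht
  have e : ∀ i j, d i * B i j * y i * y j = d i * B i j * x i * x j
      - d i * B i j * x i * (Pi.single k t : K → ℝ) j
      - d i * B i j * (Pi.single k t : K → ℝ) i * x j
      + d i * B i j * (Pi.single k t : K → ℝ) i * (Pi.single k t : K → ℝ) j := by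
    intro i j; simp only [y, Pi.sub_apply]; ring
  simp only [e, Finset.sum_add_distrib, Finset.sum_sub_distrib]
  have f1 : ∑ i, ∑ j, d i * B i j * x i * (Pi.single k t : K → ℝ) j = d k * t * t := by
    simp only [Pi.single_apply, mul_ite, mul_zero, Finset.sum_ite_eq', Finset.mem_univ, if_true]
    rw [← Finset.sum_mul]
    congr 1
    rw [ht, Finset.mul_sum]
    refine Finset.sum_congr rfl fun i _ => ?_
    rw [hsym i k]; ring
  have f2 : ∑ i, ∑ j, d i * B i j * (Pi.single k t : K → ℝ) i * x j = d k * t * t := by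
    rw [Finset.sum_comm]
    simp only [Pi.single_apply, mul_ite, ite_mul, zero_mul, mul_zero, Finset.sum_ite_eq', Finset.mem_univ, if_true]
    rw [ht, mul_assoc, Finset.sum_mul, Finset.mul_sum]
    refine Finset.sum_congr rfl fun i _ => ?_
    ring
  have f3 : ∑ i, ∑ j, d i * B i j * (Pi.single k t : K → ℝ) i * (Pi.single k t : K → ℝ) j
      = 2 * (d k * t * t) := by
    simp only [Pi.single_apply, mul_ite, ite_mul, zero_mul, mul_zero, Finset.sum_ite_eq', Finset.mem_univ, if_true]
    rw [hdiag]; ring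
  rw [f1, f2, f3]; ring

namespace GCMRealization

variable {m : ℕ} {V : Type*} [NormedAddCommGroup V] [NormedSpace ℝ V]
variable (S : GCMRealization m V)

theorem exists_min_word {I : Set (Fin m)} {w : V ≃ₗ[ℝ] V} (hw : w ∈ S.WI I) :
    ∃ n, S.IsWord I n w ∧ ∀ k < n, ¬ S.IsWord I k w := by
  classical
  obtain ⟨l, h, h'⟩ := S.exists_word hw
  have hex : ∃ n, S.IsWord I n w := ⟨l.length, l, h, rfl, h'⟩
  exact ⟨Nat.find hex, Nat.find_spec hex, fun k hk => Nat.find_min hex hk⟩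

/-- The monoid generated by the vectors `⟨η, α_j∨⟩ α_i`, `i, j ∈ I`. -/
def wtMonoid (η : V) (I : Set (Fin m)) : AddSubmonoid V :=
  AddSubmonoid.closure (Set.image2 (fun j i => S.coroot j η • S.root i) I I)

theorem sub_mem_wtMonoid_aux (η : V) (I : Set (Fin m)) (n : ℕ) : ∀ w : V ≃ₗ[ℝ] V,
    S.IsWord I n w → (∀ k < n, ¬ S.IsWord I k w) → η - w η ∈ S.wtMonoid η I := by
  induction n with
  | zero =>
    intro w hw _
    obtain ⟨l, -, h2, rfl⟩ := hw
    rw [List.length_eq_zero_iff.1 h2]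
    simp
  | succ n ih =>
    intro w hw hmin
    obtain ⟨l, h1, h2, h3⟩ := hw
    rcases List.eq_nil_or_concat l with rfl | ⟨l0, j, rfl⟩
    · simp at h2
    rw [List.concat_eq_append] at *
    have hj : j ∈ I := h1 j (by simp)
    have hw0 : S.IsWord I n (S.wd l0) :=
      ⟨l0, fun k hk => h1 k (by simp [hk]), by simpa using h2, rfl⟩
    have hww : w = S.wd l0 * S.s j := by rw [← h3]; simp
    have hjw : S.IsWord I 1 (S.s j) := ⟨[j], by simpa using hj, rfl, by simp⟩
    have hmin0 : ∀ k < n, ¬ S.IsWord I k (S.wd l0) := by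
      intro k hk h
      exact hmin (k + 1) (by omega) (hww ▸ IsWord.mul S h hjw)
    have hpos := S.root_pos I n (S.wd l0) hw0 hmin0 j hj (by
      intro k hk h
      exact hmin k (by omega) (hww ▸ h))
    have e : η - w η = (η - S.wd l0 η) + S.coroot j η • S.wd l0 (S.root j) := by
      rw [hww, LinearEquiv.mul_apply, s_apply, map_sub, map_smul]; abel
    rw [e]
    refine add_mem (ih _ hw0 hmin0) ?_
    generalize S.wd l0 (S.root j) = v at hpos
    induction hpos using AddSubmonoid.closure_induction with
    | mem x hx =>
      obtain ⟨i, hi, rfl⟩ := hx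
      exact AddSubmonoid.subset_closure ⟨j, hj, i, hi, rfl⟩
    | zero => simp
    | add x y _ _ hx hy => rw [smul_add]; exact add_mem hx hy

theorem sub_mem_wtMonoid (η : V) (I : Set (Fin m)) {w : V ≃ₗ[ℝ] V} (hw : w ∈ S.WI I) :
    η - w η ∈ S.wtMonoid η I := by
  obtain ⟨n, h1, h2⟩ := S.exists_min_word hw
  exact S.sub_mem_wtMonoid_aux η I n w h1 h2

/-! ### Coordinates -/

theorem exists_coords : ∃ g : V →ₗ[ℝ] (Fin m → ℝ), ∀ c : Fin m → ℝ, g (∑ i, c i • S.root i) = c := by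
  have hinj : LinearMap.ker (Fintype.linearCombination ℝ S.root) = ⊥ := by
    rw [LinearMap.ker_eq_bot]
    exact linearIndependent_iff_injective_fintypeLinearCombination.mp S.root_indep
  obtain ⟨g, hg⟩ := LinearMap.exists_leftInverse_of_injective _ hinj
  refine ⟨g, fun c => ?_⟩
  have := LinearMap.congr_fun hg c
  simpa [Fintype.linearCombination_apply] using this

/-- A coordinate map: a left inverse of `c ↦ ∑ c_i α_i`. -/
noncomputable def cd : V →ₗ[ℝ] (Fin m → ℝ) := S.exists_coords.choose

theorem cd_sum (c : Fin m → ℝ) : S.cd (∑ i, c i • S.root i) = c := S.exists_coords.choose_spec c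

theorem cd_root (i : Fin m) : S.cd (S.root i) = Pi.single i 1 := by
  have := S.cd_sum (Pi.single i 1)
  simpa [Pi.single_apply] using this

/-- The height functional. -/
noncomputable def ht : V →ₗ[ℝ] ℝ := (∑ i, LinearMap.proj i) ∘ₗ S.cd

theorem ht_root (i : Fin m) : S.ht (S.root i) = 1 := by
  simp [ht, cd_root]

theorem cone_zero (I : Set (Fin m)) : (0 : V) ∈ S.coneNonneg I := ⟨0, by simp, by simp, by simp⟩

theorem cone_add {I : Set (Fin m)} {x y : V} (hx : x ∈ S.coneNonneg I) (hy : y ∈ S.coneNonneg I) :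
    x + y ∈ S.coneNonneg I := by
  obtain ⟨c, h1, h2, rfl⟩ := hx
  obtain ⟨c', h1', h2', rfl⟩ := hy
  refine ⟨c + c', fun i => add_nonneg (h1 i) (h1' i), fun i hi => by simp [h2 i hi, h2' i hi], ?_⟩
  simp [add_smul, Finset.sum_add_distrib]

theorem cone_smul {I : Set (Fin m)} {x : V} (hx : x ∈ S.coneNonneg I) {t : ℝ} (ht : 0 ≤ t) :
    t • x ∈ S.coneNonneg I := by
  obtain ⟨c, h1, h2, rfl⟩ := hx
  refine ⟨t • c, fun i => mul_nonneg ht (h1 i), fun i hi => by simp [h2 i hi], ?_⟩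
  simp [Finset.smul_sum, smul_smul]

theorem cone_root {I : Set (Fin m)} {i : Fin m} (hi : i ∈ I) : S.root i ∈ S.coneNonneg I := by
  classical
  refine ⟨Pi.single i 1, ?_, ?_, ?_⟩
  · intro j; by_cases h : j = i
    · subst h; simp
    · simp [h]
  · intro j hj
    have : j ≠ i := by rintro rfl; exact hj hi
    simp [this]
  · simp [Pi.single_apply]

theorem wtMonoid_le_cone {η : V} {I : Set (Fin m)} (hη : ∀ i ∈ I, 0 ≤ S.coroot i η) {v : V}
    (hv : v ∈ S.wtMonoid η I) : v ∈ S.coneNonneg I := by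
  induction hv using AddSubmonoid.closure_induction with
  | mem x hx =>
    obtain ⟨j, hj, i, hi, rfl⟩ := hx
    exact S.cone_smul (S.cone_root hi) (hη j hj)
  | zero => exact S.cone_zero I
  | add x y _ _ hx hy => exact S.cone_add hx hy

theorem sub_mem_cone {η : V} {I : Set (Fin m)} (hη : ∀ i ∈ I, 0 ≤ S.coroot i η)
    {w : V ≃ₗ[ℝ] V} (hw : w ∈ S.WI I) : η - w η ∈ S.coneNonneg I :=
  S.wtMonoid_le_cone hη (S.sub_mem_wtMonoid η I hw)

theorem face_sub_mem_cone {μ : V} (hμ : μ ∈ S.chamber) {I : Set (Fin m)} {x : V}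
    (hx : x ∈ S.face μ I) : μ - x ∈ S.coneNonneg I := by
  have hsub : S.face μ I ⊆ {x | μ - x ∈ S.coneNonneg I} := by
    apply convexHull_min
    · rintro _ ⟨w, hw, rfl⟩
      exact S.sub_mem_cone (fun i _ => hμ i) hw
    · intro x hx y hy a b ha hb hab
      have : μ - (a • x + b • y) = a • (μ - x) + b • (μ - y) := by
        have : μ = (a + b) • μ := by rw [hab, one_smul]
        nth_rewrite 1 [this]
        module
      show μ - (a • x + b • y) ∈ S.coneNonneg I
      rw [this]
      exact S.cone_add (S.cone_smul hx ha) (S.cone_smul hy hb)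
  exact hsub hx

theorem mu_mem_face (μ : V) (I : Set (Fin m)) : μ ∈ S.face μ I :=
  subset_convexHull _ _ ⟨1, one_mem _, rfl⟩

theorem image_face (μ : V) (I : Set (Fin m)) {w : V ≃ₗ[ℝ] V} (hw : w ∈ S.WI I) :
    w '' S.face μ I = S.face μ I := by
  have h : w '' S.face μ I = convexHull ℝ (w '' orbitOf (S.WI I) μ) :=
    (w : V →ₗ[ℝ] V).image_convexHull _
  rw [h, face]
  congr 1
  ext y
  constructor
  · rintro ⟨_, ⟨u, hu, rfl⟩, rfl⟩
    exact ⟨w * u, mul_mem hw hu, rfl⟩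
  · rintro ⟨u, hu, rfl⟩
    exact ⟨(w⁻¹ * u) μ, ⟨w⁻¹ * u, mul_mem (inv_mem hw) hu, rfl⟩, by
      show (w * (w⁻¹ * u)) μ = u μ
      rw [mul_inv_cancel_left]⟩

theorem mem_face_of_mem {μ : V} {I : Set (Fin m)} {w : V ≃ₗ[ℝ] V} (hw : w ∈ S.WI I) {x : V}
    (hx : x ∈ S.face μ I) : w x ∈ S.face μ I := by
  rw [← S.image_face μ I hw]; exact mem_image_of_mem _ hx

theorem image_ri (μ : V) (I : Set (Fin m)) {w : V ≃ₗ[ℝ] V} (hw : w ∈ S.WI I) :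
    w '' intrinsicInterior ℝ (S.face μ I) = intrinsicInterior ℝ (S.face μ I) := by
  have := S.finDim
  have := w.toAffineEquiv.intrinsicInterior_image (S.face μ I)
  have e : (w.toAffineEquiv : V → V) = w := rfl
  rw [e, S.image_face μ I hw] at this
  exact this.symm

theorem coroot_nonneg_off {μ : V} (hμ : μ ∈ S.chamber) {I : Set (Fin m)} {x : V}
    (hx : μ - x ∈ S.coneNonneg I) {j : Fin m} (hj : j ∉ I) : 0 ≤ S.coroot j x := by
  obtain ⟨c, h1, h2, h3⟩ := hx
  have : x = μ - ∑ i, c i • S.root i := by rw [← h3]; abel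
  rw [this, map_sub, map_sum]
  have h4 : ∑ i, S.coroot j (c i • S.root i) ≤ 0 := by
    apply Finset.sum_nonpos
    intro i _
    rw [map_smul, smul_eq_mul, S.pairing]
    by_cases hi : i ∈ I
    · have hne : j ≠ i := by rintro rfl; exact hj hi
      have : (S.A j i : ℝ) ≤ 0 := by exact_mod_cast S.A_offdiag j i hne
      exact mul_nonpos_of_nonneg_of_nonpos (h1 i) this
    · simp [h2 i hi]
  have := hμ j
  linarith

theorem exists_dominant {μ : V} (hμ : μ ∈ S.chamber) {I : Set (Fin m)} {x : V}
    (hx : x ∈ S.face μ I) : ∃ w ∈ S.WI I, w x ∈ S.chamber := by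
  have hx' := hx
  rw [face, mem_convexHull_iff_exists_fintype] at hx'
  obtain ⟨ι, _, t, z, ht0, ht1, hz, hxz⟩ := hx'
  choose u hu huz using hz
  let M : AddSubmonoid ℝ := AddSubmonoid.closure (Set.range fun q : ι × Fin m => t q.1 * S.coroot q.2 μ)
  have hM : (M : Set ℝ).IsPWO := by
    apply Set.IsPWO.addSubmonoid_closure
    · rintro _ ⟨q, rfl⟩
      exact mul_nonneg (ht0 _) (hμ _)
    · exact (Set.finite_range _).isPWO
  have hval : ∀ w ∈ S.WI I, S.ht (μ - w x) ∈ M := by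
    intro w hw
    have e : μ - w x = ∑ k, t k • (μ - w (z k)) := by
      simp only [smul_sub, Finset.sum_sub_distrib, ← Finset.sum_smul, ht1, one_smul]
      rw [← hxz, map_sum]
      simp
    rw [e, map_sum]
    refine sum_mem fun k _ => ?_
    have h1 : μ - w (z k) ∈ S.wtMonoid μ I := by
      rw [← huz k]
      exact S.sub_mem_wtMonoid μ I (mul_mem hw (hu k))
    generalize μ - w (z k) = v at h1
    induction h1 using AddSubmonoid.closure_induction with
    | mem x hx =>
      obtain ⟨j, hj, i, hi, rfl⟩ := hx
      simp only [map_smul, ht_root, smul_eq_mul, mul_one]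
      exact AddSubmonoid.subset_closure ⟨(k, j), rfl⟩
    | zero => simp
    | add x y _ _ hx hy => rw [smul_add, map_add]; exact add_mem hx hy
  have hT : ((fun w : V ≃ₗ[ℝ] V => S.ht (μ - w x)) '' (S.WI I : Set (V ≃ₗ[ℝ] V))).IsWF := by
    apply (hM.mono _).isWF
    rintro _ ⟨w, hw, rfl⟩
    exact hval w hw
  have hTne : ((fun w : V ≃ₗ[ℝ] V => S.ht (μ - w x)) '' (S.WI I : Set (V ≃ₗ[ℝ] V))).Nonempty :=
    ⟨_, 1, one_mem _, rfl⟩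
  obtain ⟨w, hw, hwm⟩ := hT.min_mem hTne
  refine ⟨w, hw, fun i => ?_⟩
  by_cases hi : i ∈ I
  · by_contra hneg
    push Not at hneg
    have hmin := hT.min_le hTne (mem_image_of_mem (fun w : V ≃ₗ[ℝ] V => S.ht (μ - w x))
      (mul_mem (S.s_mem_WI hi) hw : S.s i * w ∈ S.WI I))
    rw [← hwm] at hmin
    simp only [LinearEquiv.mul_apply, s_apply, map_sub, map_smul, ht_root, smul_eq_mul] at hmin
    linarith
  · exact S.coroot_nonneg_off hμ (S.face_sub_mem_cone hμ (S.mem_face_of_mem hw hx)) hi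

/-- Part (1). -/
theorem part1 {μ : V} (hμ : μ ∈ S.chamber) (I : Set (Fin m)) :
    intrinsicInterior ℝ (S.face μ I) =
      Set.image2 (fun (w : V ≃ₗ[ℝ] V) (x : V) => w x) (S.WI I : Set (V ≃ₗ[ℝ] V))
        (intrinsicInterior ℝ (S.face μ I) ∩ S.chamber) := by
  ext x
  constructor
  · intro hx
    obtain ⟨w, hw, hwx⟩ := S.exists_dominant hμ (intrinsicInterior_subset hx)
    refine ⟨w⁻¹, inv_mem hw, w x, ⟨?_, hwx⟩, ?_⟩
    · rw [← S.image_ri μ I hw]; exact mem_image_of_mem _ hx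
    · show (w⁻¹ * w) x = x
      rw [inv_mul_cancel]; rfl
  · rintro ⟨w, hw, y, ⟨hy, -⟩, rfl⟩
    rw [← S.image_ri μ I hw]; exact mem_image_of_mem _ hy

end GCMRealization

namespace GCMRealization
variable {m : ℕ} {V : Type*} [NormedAddCommGroup V] [NormedSpace ℝ V]
variable (S : GCMRealization m V)

/-- The action of the Cartan matrix on real vectors. -/
def L (c : Fin m → ℝ) (i : Fin m) : ℝ := ∑ j, (S.A i j : ℝ) * c j

theorem coroot_sum (c : Fin m → ℝ) (i : Fin m) :
    S.coroot i (∑ j, c j • S.root j) = S.L c i := by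
  simp only [map_sum, map_smul, S.pairing, L, smul_eq_mul]
  exact Finset.sum_congr rfl fun j _ => mul_comm _ _

theorem off_nonpos {i j : Fin m} (h : i ≠ j) : (S.A i j : ℝ) ≤ 0 := by
  exact_mod_cast S.A_offdiag i j h

theorem A_diag_real (i : Fin m) : (S.A i i : ℝ) = 2 := by rw [S.A_diag]; norm_num

theorem off_int {i j : Fin m} (h : i ≠ j) (h0 : (S.A i j : ℝ) ≠ 0) : (S.A i j : ℝ) ≤ -1 := by
  have h1 := S.A_offdiag i j h
  have h2 : S.A i j ≠ 0 := by exact_mod_cast h0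
  have : S.A i j ≤ -1 := by omega
  exact_mod_cast this

theorem A_zero_real (i j : Fin m) : (S.A i j : ℝ) = 0 ↔ (S.A j i : ℝ) = 0 := by
  have := S.A_zero_iff i j
  exact_mod_cast this

theorem sum_sub_eq {M : Type*} [AddCommMonoid M] (K : Set (Fin m)) [Fintype K] (f : Fin m → M)
    (h : ∀ i, i ∉ K → f i = 0) : ∑ i : K, f i = ∑ i, f i := by
  classical
  rw [← Finset.sum_subtype (Finset.univ.filter (· ∈ K)) (by simp)]
  rw [Finset.sum_filter]
  exact Finset.sum_congr rfl fun i _ => by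
    by_cases hi : i ∈ K
    · simp [hi]
    · simp [hi, h i hi]

theorem L_sub (K : Set (Fin m)) [Fintype K] (c : Fin m → ℝ) (h : ∀ i, i ∉ K → c i = 0)
    (i : Fin m) : ∑ j : K, (S.A i j : ℝ) * c j = S.L c i :=
  sum_sub_eq K (fun j => (S.A i j : ℝ) * c j) fun j hj => by simp [h j hj]

theorem L_add (c d : Fin m → ℝ) (i : Fin m) : S.L (c + d) i = S.L c i + S.L d i := by
  simp [L, mul_add, Finset.sum_add_distrib]

theorem L_smul (t : ℝ) (d : Fin m → ℝ) (i : Fin m) : S.L (t • d) i = t * S.L d i := by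
  simp only [L, Finset.mul_sum, Pi.smul_apply, smul_eq_mul]
  exact Finset.sum_congr rfl fun j _ => by ring

theorem L_subv (c d : Fin m → ℝ) (i : Fin m) : S.L (c - d) i = S.L c i - S.L d i := by
  simp [L, mul_sub, Finset.sum_sub_distrib]

/-- `p` is strictly positive on `K` and zero elsewhere. -/
def PosOn (K : Set (Fin m)) (p : Fin m → ℝ) : Prop := (∀ i ∈ K, 0 < p i) ∧ ∀ i, i ∉ K → p i = 0

open Classical in
theorem extend_exists (K : Set (Fin m)) (p : K → ℝ) : ∃ q : Fin m → ℝ, (∀ i, i ∉ K → q i = 0) ∧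
    ∀ i : K, q i = p i :=
  ⟨fun i => if h : i ∈ K then p ⟨i, h⟩ else 0, fun i hi => by simp [hi], fun i => by simp⟩

theorem fin_strict (K : Set (Fin m)) (p : Fin m → ℝ) (hp : PosOn K p)
    (h0 : ∀ i ∈ K, 0 ≤ S.L p i)
    (hZ : ∀ Z : Set (Fin m), Z ⊆ K → Z.Nonempty → (∀ i ∈ Z, ∀ j ∈ K, S.A i j ≠ 0 → j ∈ Z) →
      ∃ i ∈ Z, 0 < S.L p i) :
    ∃ q : Fin m → ℝ, PosOn K q ∧ ∀ i ∈ K, 0 < S.L q i := by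
  classical
  obtain ⟨p', h1, h2⟩ := mmat_strict (fun i j : K => (S.A i j : ℝ))
    (fun i j hij => S.off_nonpos (fun h => hij (Subtype.ext h))) _ (fun i => p i)
    (fun i => hp.1 i i.2) (fun i => by rw [S.L_sub K p hp.2]; exact h0 i i.2) (by
      intro Z hZn hZc
      obtain ⟨i, ⟨i', hi', rfl⟩, hi2⟩ := hZ (Subtype.val '' Z) (by rintro _ ⟨x, _, rfl⟩; exact x.2)
        (hZn.image _) (by
          rintro _ ⟨x, hx, rfl⟩ j hj hA
          exact ⟨⟨j, hj⟩, hZc x hx ⟨j, hj⟩ (by exact_mod_cast hA), rfl⟩)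
      refine ⟨i', hi', ?_⟩
      rw [S.L_sub K p hp.2]; exact hi2) rfl
  obtain ⟨q, hq, hq'⟩ := extend_exists K p'
  refine ⟨q, ⟨fun i hi => by rw [hq' ⟨i, hi⟩]; exact h1 _, hq⟩, fun i hi => ?_⟩
  rw [← S.L_sub K q hq]
  simpa [hq'] using h2 ⟨i, hi⟩

theorem fin_compare (K : Set (Fin m)) (p : Fin m → ℝ) (hp : PosOn K p)
    (h0 : ∀ i ∈ K, 0 < S.L p i) (d : Fin m → ℝ) (hd : ∀ i, i ∉ K → d i = 0)
    (hd2 : ∀ i ∈ K, 0 < d i → S.L d i ≤ 0) (i : Fin m) : d i ≤ 0 := by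
  classical
  by_cases hi : i ∈ K
  · exact mmat_compare (fun i j : K => (S.A i j : ℝ))
      (fun i j hij => S.off_nonpos (fun h => hij (Subtype.ext h))) (fun i => p i) (fun i => d i)
      (fun i => hp.1 i i.2) (fun i => by rw [S.L_sub K p hp.2]; exact h0 i i.2)
      (fun i h => by rw [S.L_sub K d hd]; exact hd2 i i.2 h) ⟨i, hi⟩
  · exact (hd i hi).le

theorem fin_inj (K : Set (Fin m)) (p : Fin m → ℝ) (hp : PosOn K p)
    (h0 : ∀ i ∈ K, 0 < S.L p i) (d : Fin m → ℝ) (hd : ∀ i, i ∉ K → d i = 0)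
    (hd2 : ∀ i ∈ K, S.L d i = 0) : d = 0 := by
  funext i
  have h1 := S.fin_compare K p hp h0 d hd (fun i hi _ => (hd2 i hi).le) i
  have h2 := S.fin_compare K p hp h0 ((-1 : ℝ) • d) (fun i hi => by simp [hd i hi])
    (fun i hi _ => by rw [L_smul, hd2 i hi]; simp) i
  simp at h2 ⊢
  linarith

theorem fin_surj (K : Set (Fin m)) (p : Fin m → ℝ) (hp : PosOn K p)
    (h0 : ∀ i ∈ K, 0 < S.L p i) (g : Fin m → ℝ) :
    ∃ d : Fin m → ℝ, (∀ i, i ∉ K → d i = 0) ∧ ∀ i ∈ K, S.L d i = g i := by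
  classical
  obtain ⟨d, hd⟩ := mmat_surj (fun i j : K => (S.A i j : ℝ))
      (fun i j hij => S.off_nonpos (fun h => hij (Subtype.ext h))) (fun i => p i)
      (fun i => hp.1 i i.2) (fun i => by rw [S.L_sub K p hp.2]; exact h0 i i.2) (fun i => g i)
  obtain ⟨q, hq, hq'⟩ := extend_exists K d
  refine ⟨q, hq, fun i hi => ?_⟩
  rw [← S.L_sub K q hq]
  simpa [hq'] using hd ⟨i, hi⟩

theorem WI_fix {K : Set (Fin m)} {w : V ≃ₗ[ℝ] V} (hw : w ∈ S.WI K) {x : V}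
    (hx : ∀ i ∈ K, S.coroot i x = 0) : w x = x := by
  obtain ⟨l, hl, rfl⟩ := S.exists_word hw
  induction l with
  | nil => rfl
  | cons a l ih =>
    rw [wd_cons, LinearEquiv.mul_apply,
      ih (fun k hk => hl k (by simp [hk])) (S.wd_mem_WI l fun k hk => hl k (by simp [hk])),
      s_apply, hx a (hl a (by simp))]
    simp

theorem WI_mono {K K' : Set (Fin m)} (h : K ⊆ K') : S.WI K ≤ S.WI K' :=
  Subgroup.closure_mono (image_mono h)

theorem finiteType_of_pos (K : Set (Fin m)) (p : Fin m → ℝ) (hp : PosOn K p)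
    (h0 : ∀ i ∈ K, 0 < S.L p i) : S.FiniteType K := by
  classical
  set B : K → K → ℝ := fun i j => (S.A i j : ℝ) with hB
  have hoff : ∀ i j, i ≠ j → B i j ≤ 0 := fun i j hij => S.off_nonpos (fun h => hij (Subtype.ext h))
  have hBp : ∀ i, 0 < ∑ j, B i j * p j := fun i => by rw [S.L_sub K p hp.2]; exact h0 i i.2
  have hpp : ∀ i : K, 0 < p i := fun i => hp.1 i i.2
  obtain ⟨d, hd, hsym'⟩ := mmat_symm B (fun i => S.A_diag_real i) hoff
    (fun i j hij => S.off_int (fun h => hij (Subtype.ext h)))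
    (fun i j => S.A_zero_real i j) (fun i => p i) hpp hBp _ Finset.univ rfl
  have hsym : ∀ i j, d i * B i j = d j * B j i := fun i j => hsym' i (by simp) j (by simp)
  set q : (K → ℤ) → ℝ := fun n => ∑ i, ∑ j, d i * B i j * (n i : ℝ) * (n j : ℝ) with hq
  set R : (K → ℤ) → V := fun n => ∑ i : K, (n i : ℝ) • S.root i with hR
  have hstep : ∀ (k : K) (n : K → ℤ), ∃ n' : K → ℤ, S.s k (R n) = R n' ∧ q n' = q n := by
    intro k n
    obtain ⟨N, hN⟩ : ∃ N : ℤ, (N : ℝ) = ∑ j : K, B k j * (n j : ℝ) :=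
      ⟨∑ j : K, (S.A k j : ℤ) * n j, by push_cast; rfl⟩
    refine ⟨n - Pi.single k N, ?_, ?_⟩
    · rw [s_apply]
      have h1 : S.coroot k (R n) = N := by
        rw [hN]
        simp only [hR, map_sum, map_smul, S.pairing, smul_eq_mul]
        exact Finset.sum_congr rfl fun j _ => mul_comm _ _
      rw [h1]
      simp only [hR, Pi.sub_apply, Int.cast_sub, sub_smul, Finset.sum_sub_distrib]
      congr 1
      rw [Finset.sum_eq_single k]
      · simp only [Pi.single_eq_same]
      · intro b _ hb; simp [hb]
      · simp
    · have := mmat_invariant B (fun i => S.A_diag_real i) d hsym (fun i => (n i : ℝ)) k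
      simp only [← hN] at this
      have e : ∀ i : K, (((n - Pi.single k N : K → ℤ) i : ℤ) : ℝ) =
          ((fun i => (n i : ℝ)) - Pi.single k (N : ℝ) : K → ℝ) i := by
        intro i
        by_cases hi : i = k
        · subst hi; simp
        · simp [hi]
      simp only [hq, e]
      exact this
  have hword : ∀ (l : List (Fin m)), (∀ k ∈ l, k ∈ K) → ∀ j : K,
      ∃ n : K → ℤ, S.wd l (S.root j) = R n ∧ q n = q (Pi.single j 1) := by
    intro l
    induction l with
    | nil =>
      intro _ j
      refine ⟨Pi.single j 1, ?_, rfl⟩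
      simp only [hR, wd_nil]
      rw [Finset.sum_eq_single j]
      · simp
      · intro b _ hb; simp [hb]
      · simp
    | cons a l ih =>
      intro hl j
      obtain ⟨n, h1, h2⟩ := ih (fun k hk => hl k (by simp [hk])) j
      obtain ⟨n', h3, h4⟩ := hstep ⟨a, hl a (by simp)⟩ n
      refine ⟨n', ?_, h4.trans h2⟩
      rw [wd_cons, LinearEquiv.mul_apply, h1, h3]
  have hbdd : ∀ j : K, {n : K → ℤ | q n = q (Pi.single j 1)}.Finite := by
    intro j
    set M := q (Pi.single j 1)
    set e : K → ℝ := fun i => d i * (∑ j, B i j * p j) / p i with he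
    have hepos : ∀ i, 0 < e i := fun i => div_pos (mul_pos (hd i) (hBp i)) (hpp i)
    apply (Set.finite_Icc (fun i : K => -⌈M / e i⌉) (fun i : K => ⌈M / e i⌉)).subset
    intro n hn
    have hpd := mmat_posdef B hoff (fun i => p i) hpp d hd hsym (fun i => (n i : ℝ))
    have key : ∀ i, |n i| ≤ ⌈M / e i⌉ := by
      intro i
      have h1 : e i * (n i : ℝ) ^ 2 ≤ M := by
        have hn' : q n = M := hn
        rw [← hn']
        refine le_trans ?_ hpd
        exact Finset.single_le_sum (f := fun i => e i * (n i : ℝ) ^ 2)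
          (fun i _ => mul_nonneg (hepos i).le (sq_nonneg _)) (Finset.mem_univ i)
      have h2 : (n i : ℝ) ^ 2 ≤ M / e i := by
        rw [le_div_iff₀ (hepos i)]; linarith
      have h3 : |n i| ≤ n i ^ 2 := by
        rw [← sq_abs]
        rcases (abs_nonneg (n i)).eq_or_lt with h | h
        · rw [← h]; simp
        · nlinarith
      have h4 : ((|n i| : ℤ) : ℝ) ≤ M / e i := by
        refine le_trans ?_ h2
        exact_mod_cast h3
      have h5 := h4.trans (Int.le_ceil _)
      exact_mod_cast h5
    exact ⟨fun i => (abs_le.1 (key i)).1, fun i => (abs_le.1 (key i)).2⟩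
  have hfin : (Set.pi Set.univ fun j : K => R '' {n : K → ℤ | q n = q (Pi.single j 1)}).Finite :=
    Set.Finite.pi fun j => (hbdd j).image R
  apply Set.Finite.of_injOn (f := fun (w : V ≃ₗ[ℝ] V) (j : K) => w (S.root j)) ?_ ?_ hfin
  · intro w hw j _
    obtain ⟨l, hl, rfl⟩ := S.exists_word hw
    obtain ⟨n, h1, h2⟩ := hword l hl j
    exact ⟨n, h2, h1.symm⟩
  · intro w hw w' hw' hww
    ext x
    obtain ⟨c, hc, hc'⟩ := S.fin_surj K p hp h0 (fun i => S.coroot i x)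
    have hx0 : ∀ i ∈ K, S.coroot i (x - ∑ j, c j • S.root j) = 0 := by
      intro i hi
      rw [map_sub, coroot_sum, hc' i hi, sub_self]
    have e : ∀ w ∈ S.WI K, w x = (x - ∑ j, c j • S.root j) + ∑ j : K, c j • w (S.root j) := by
      intro w hw
      have h1 := S.WI_fix hw hx0
      rw [map_sub, sub_eq_iff_eq_add] at h1
      rw [h1]
      congr 1
      rw [← sum_sub_eq K (fun j => c j • S.root j) (fun i hi => by simp [hc i hi])]
      simp
    rw [e w hw, e w' hw']
    congr 1
    exact Finset.sum_congr rfl fun j _ => by rw [show w (S.root j) = w' (S.root j) from congrFun hww j]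

end GCMRealization

namespace GCMRealization
variable {m : ℕ} {V : Type*} [NormedAddCommGroup V] [NormedSpace ℝ V]
variable (S : GCMRealization m V)

theorem diagram_adj_of {I : Set (Fin m)} {i j : I} (hij : i ≠ j) (h : S.A i j ≠ 0) :
    (S.diagram.induce I).Adj i j :=
  ⟨fun e => hij (Subtype.ext e), h, fun h' => h ((S.A_zero_iff _ _).2 h')⟩

theorem reachable_closed {I Z : Set (Fin m)}
    (hZ : ∀ i ∈ Z, ∀ j ∈ I, S.A i j ≠ 0 → j ∈ Z) {i j : I}
    (h : (S.diagram.induce I).Reachable i j) (hi : (i : Fin m) ∈ Z) : (j : Fin m) ∈ Z := by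
  obtain ⟨p⟩ := h
  induction p with
  | nil => exact hi
  | cons hadj _ ih => exact ih (hZ _ hi _ (Subtype.prop _) hadj.2.1)

theorem mu_closed {μ : V} {I : Set (Fin m)} (hcon : S.MuConnected μ I) (hμ : μ ∈ S.chamber)
    (Z : Set (Fin m)) (hZI : Z ⊆ I) (hne : Z.Nonempty)
    (hZ : ∀ i ∈ Z, ∀ j ∈ I, S.A i j ≠ 0 → j ∈ Z) : ∃ i ∈ Z, 0 < S.coroot i μ := by
  obtain ⟨i, hi⟩ := hne
  obtain ⟨j, hj, hr⟩ := hcon ⟨i, hZI hi⟩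
  exact ⟨j, S.reachable_closed hZ hr hi, lt_of_le_of_ne (hμ j) hj.symm⟩

theorem exists_weight (g : Fin m → ℝ) : ∃ η : V, ∀ i, S.coroot i η = g i := by
  classical
  have hsurj : LinearMap.range (LinearMap.pi S.coroot) = ⊤ := by
    by_contra hne
    obtain ⟨f, hf, hle⟩ := Submodule.exists_le_ker_of_lt_top _ (lt_top_iff_ne_top.2 hne)
    apply hf
    have h0 : ∑ i, f (Pi.single i 1) • S.coroot i = 0 := by
      ext x
      have h1 : f (LinearMap.pi S.coroot x) = 0 := hle ⟨x, rfl⟩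
      rw [LinearMap.pi_apply_eq_sum_univ f] at h1
      simp only [LinearMap.sum_apply, LinearMap.smul_apply, LinearMap.zero_apply]
      rw [← h1]
      refine Finset.sum_congr rfl fun i _ => ?_
      rw [smul_eq_mul, smul_eq_mul, mul_comm]
      congr 2
      ext j
      by_cases hij : i = j
      · subst hij; simp
      · simp [hij, Ne.symm hij]
    have h2 := Fintype.linearIndependent_iff.1 S.coroot_indep _ h0
    apply LinearMap.pi_ext'
    intro i
    ext
    simpa using h2 i
  obtain ⟨η, hη⟩ := LinearMap.range_eq_top.1 hsurj g
  exact ⟨η, fun i => congrFun hη i⟩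

/-- The elements of a finite parabolic subgroup, as a finset. -/
noncomputable def elts {K : Set (Fin m)} (hfin : S.FiniteType K) : Finset (V ≃ₗ[ℝ] V) :=
  Set.Finite.toFinset (s := ((S.WI K : Subgroup (V ≃ₗ[ℝ] V)) : Set (V ≃ₗ[ℝ] V))) hfin

theorem mem_elts {K : Set (Fin m)} (hfin : S.FiniteType K) (w : V ≃ₗ[ℝ] V) :
    w ∈ S.elts hfin ↔ w ∈ S.WI K := by
  exact Set.Finite.mem_toFinset (s := ((S.WI K : Subgroup (V ≃ₗ[ℝ] V)) : Set (V ≃ₗ[ℝ] V))) hfin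

theorem avg_inv {K : Set (Fin m)} (hfin : S.FiniteType K) {u : V ≃ₗ[ℝ] V} (hu : u ∈ S.WI K)
    (x : V) : u (∑ w ∈ S.elts hfin, w x) = ∑ w ∈ S.elts hfin, w x := by
  rw [map_sum]
  refine Finset.sum_equiv (Equiv.mulLeft u) ?_ ?_
  · intro w
    rw [mem_elts, mem_elts, Equiv.coe_mulLeft]
    exact ((S.WI K).mul_mem_cancel_left hu).symm
  · intro w _
    simp

theorem avg_coroot {K : Set (Fin m)} (hfin : S.FiniteType K) {i : Fin m} (hi : i ∈ K)
    (x : V) : S.coroot i (∑ w ∈ S.elts hfin, w x) = 0 := by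
  have h := S.avg_inv hfin (S.s_mem_WI hi) x
  generalize (∑ w ∈ S.elts hfin, w x) = y at h ⊢
  rw [s_apply] at h
  have h1 := congrArg (S.coroot i) h
  rw [map_sub, map_smul, coroot_root_self, smul_eq_mul] at h1
  linarith

theorem card_pos_toFinset {K : Set (Fin m)} (hfin : S.FiniteType K) :
    0 < ((S.elts hfin).card : ℝ) := by
  have : 0 < (S.elts hfin).card := Finset.card_pos.2 ⟨1, by rw [mem_elts]; exact one_mem _⟩
  exact_mod_cast this

theorem solve_fin {K : Set (Fin m)} (hfin : S.FiniteType K) (g : Fin m → ℝ) (hg : ∀ i, 0 ≤ g i) :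
    ∃ c : Fin m → ℝ, (∀ i, 0 ≤ c i) ∧ (∀ i, i ∉ K → c i = 0) ∧ ∀ i ∈ K, S.L c i = g i := by
  obtain ⟨η, hη⟩ := S.exists_weight g
  set N : ℝ := ((S.elts hfin).card : ℝ) with hN
  have hNpos : 0 < N := S.card_pos_toFinset hfin
  have h1 : ∀ T : Finset (V ≃ₗ[ℝ] V), (∀ w ∈ T, w ∈ S.WI K) →
      ∑ w ∈ T, (η - w η) ∈ S.coneNonneg K := by
    intro T hT
    refine Finset.sum_induction _ (· ∈ S.coneNonneg K) (fun _ _ => S.cone_add) (S.cone_zero K) ?_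
    intro w hw
    exact S.sub_mem_cone (fun i _ => by rw [hη]; exact hg i) (hT w hw)
  have h2 := S.cone_smul (h1 (S.elts hfin) (fun w hw => (S.mem_elts hfin w).1 hw)) (inv_nonneg.2 hNpos.le)
  obtain ⟨c, hc1, hc2, hc3⟩ := h2
  refine ⟨c, hc1, hc2, fun i hi => ?_⟩
  rw [← coroot_sum, ← hc3, map_smul, Finset.sum_sub_distrib, map_sub, S.avg_coroot hfin hi]
  simp only [Finset.sum_const, sub_zero, map_nsmul, hη, nsmul_eq_mul, smul_eq_mul]
  rw [← hN]
  field_simp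

theorem comp_eq_of {K : Set (Fin m)} {i j : Fin m} (hi : i ∈ K) (hj : j ∈ K) (h : S.A i j ≠ 0) :
    S.comp K i = S.comp K j := by
  have hr : (S.diagram.induce K).Reachable ⟨i, hi⟩ ⟨j, hj⟩ := by
    by_cases hij : i = j
    · subst hij; rfl
    · exact (S.diagram_adj_of (i := ⟨i, hi⟩) (j := ⟨j, hj⟩) (by simpa using hij) h).reachable
  ext k
  constructor
  · rintro ⟨_, hk, h⟩; exact ⟨hj, hk, hr.symm.trans h⟩
  · rintro ⟨_, hk, h⟩; exact ⟨hi, hk, hr.trans h⟩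

theorem solve_comp {K : Set (Fin m)} (hfin : S.FinTypeComponents K) (g : Fin m → ℝ)
    (hg : ∀ i, 0 ≤ g i) :
    ∃ c : Fin m → ℝ, (∀ i, 0 ≤ c i) ∧ (∀ i, i ∉ K → c i = 0) ∧ ∀ i ∈ K, S.L c i = g i := by
  classical
  have h : ∀ J : Set (Fin m), ∃ c : Fin m → ℝ, (∀ i, 0 ≤ c i) ∧ (∀ i, i ∉ J → c i = 0) ∧
      (S.FiniteType J → ∀ i ∈ J, S.L c i = g i) := by
    intro J
    by_cases hJ : S.FiniteType J
    · obtain ⟨c, h1, h2, h3⟩ := S.solve_fin hJ g hg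
      exact ⟨c, h1, h2, fun _ => h3⟩
    · exact ⟨0, by simp, by simp, fun h => absurd h hJ⟩
  choose f h1 h2 h3 using h
  refine ⟨fun j => if j ∈ K then f (S.comp K j) j else 0, ?_, ?_, ?_⟩
  · intro i
    by_cases hi : i ∈ K <;> simp [hi, h1]
  · intro i hi; simp [hi]
  · intro i hi
    rw [← h3 (S.comp K i) (hfin i hi) i ⟨hi, hi, SimpleGraph.Reachable.refl _⟩]
    unfold L
    refine Finset.sum_congr rfl fun j _ => ?_
    by_cases hA : S.A i j = 0
    · rw [hA]; simp
    · congr 1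
      by_cases hj : j ∈ K
      · simp only [hj, if_true]
        rw [S.comp_eq_of hi hj hA]
      · simp only [hj, if_false]
        rw [h2]
        rintro ⟨_, h, _⟩; exact hj h

theorem finTypeComponents_of {K : Set (Fin m)} (h : S.FiniteType K) : S.FinTypeComponents K := by
  intro i _
  exact h.subset (S.WI_mono (by rintro j ⟨_, hj, _⟩; exact hj))

end GCMRealization

namespace GCMRealization
variable {m : ℕ} {V : Type*} [NormedAddCommGroup V] [NormedSpace ℝ V]
variable (S : GCMRealization m V)

theorem L_term_nonpos {c : Fin m → ℝ} (hc : ∀ i, 0 ≤ c i) {i : Fin m} (hi : c i = 0) (j : Fin m) :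
    (S.A i j : ℝ) * c j ≤ 0 := by
  by_cases hij : i = j
  · subst hij; rw [hi, mul_zero]
  · exact mul_nonpos_of_nonpos_of_nonneg (S.off_nonpos hij) (hc j)

theorem L_nonpos {c : Fin m → ℝ} (hc : ∀ i, 0 ≤ c i) {i : Fin m} (hi : c i = 0) : S.L c i ≤ 0 :=
  Finset.sum_nonpos fun j _ => S.L_term_nonpos hc hi j

theorem zero_spread {c : Fin m → ℝ} (hc : ∀ i, 0 ≤ c i) {i : Fin m} (hi : c i = 0)
    (h : 0 ≤ S.L c i) {j : Fin m} (hA : S.A i j ≠ 0) : c j = 0 := by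
  have h0 : S.L c i = 0 := le_antisymm (S.L_nonpos hc hi) h
  have h1 := (Finset.sum_eq_zero_iff_of_nonpos fun j _ => S.L_term_nonpos hc hi j).1 h0 j
    (Finset.mem_univ _)
  rcases mul_eq_zero.1 h1 with h2 | h2
  · exact absurd (by exact_mod_cast h2) hA
  · exact h2

theorem PosOn.nonneg {K : Set (Fin m)} {p : Fin m → ℝ} (h : PosOn K p) (i : Fin m) : 0 ≤ p i := by
  by_cases hi : i ∈ K
  · exact (h.1 i hi).le
  · exact (h.2 i hi).ge

theorem strict_sub {μ : V} (hμ : μ ∈ S.chamber) {I : Set (Fin m)} (hcon : S.MuConnected μ I)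
    {K : Set (Fin m)} (hK : K ⊆ I) {c : Fin m → ℝ} (hc : PosOn I c)
    (h : ∀ i ∈ K, S.coroot i μ ≤ S.L c i) : ∃ q, PosOn K q ∧ ∀ i ∈ K, 0 < S.L q i := by
  classical
  set p : Fin m → ℝ := fun i => if i ∈ K then c i else 0 with hp
  set r : Fin m → ℝ := c - p with hr
  have hr0 : ∀ i, 0 ≤ r i := by
    intro i
    by_cases hi : i ∈ K
    · simp [hr, hp, hi]
    · simpa [hr, hp, hi] using hc.nonneg i
  have hrK : ∀ i ∈ K, r i = 0 := fun i hi => by simp [hr, hp, hi]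
  have hrK' : ∀ i, i ∉ K → r i = c i := fun i hi => by simp [hr, hp, hi]
  have hLr : ∀ i, S.L r i = S.L c i - S.L p i := fun i => S.L_subv c p i
  have hr1 : ∀ i ∈ K, S.L r i ≤ 0 := fun i hi => S.L_nonpos hr0 (hrK i hi)
  refine S.fin_strict K p ⟨fun i hi => by simpa [hp, hi] using hc.1 i (hK hi),
    fun i hi => by simp [hp, hi]⟩ ?_ ?_
  · intro i hi
    have := hr1 i hi; have := hLr i; have := h i hi; have := hμ i
    linarith
  · intro Z hZK hne hZ
    by_contra! hcontra
    obtain ⟨i, hi, hpos⟩ := S.mu_closed hcon hμ Z (hZK.trans hK) hne (by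
      intro i hi j hj hA
      have h1 := hr1 i (hZK hi)
      have h2 := hLr i
      have h3 := h i (hZK hi)
      have h4 := hμ i
      have h5 := hcontra i hi
      have h6 := S.zero_spread hr0 (hrK i (hZK hi)) (by linarith) hA
      by_cases hjK : j ∈ K
      · exact hZ i hi j hjK hA
      · rw [hrK' j hjK] at h6
        exact absurd h6 (hc.1 j hj).ne')
    have h1 := hr1 i (hZK hi)
    have h2 := hLr i
    have h3 := h i (hZK hi)
    have h5 := hcontra i hi
    linarith

theorem coroot_sub_sum (μ : V) (c : Fin m → ℝ) (i : Fin m) :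
    S.coroot i (μ - ∑ j, c j • S.root j) = S.coroot i μ - S.L c i := by
  rw [map_sub, coroot_sum]

theorem star_zero {μ : V} {I : Set (Fin m)} {c : Fin m → ℝ} (hc : PosOn I c) {i : Fin m}
    (hi : i ∈ S.starSet μ I) : S.coroot i μ - S.L c i = 0 := by
  obtain ⟨h1, h2, h3⟩ := hi
  rw [h1, zero_sub, neg_eq_zero]
  refine Finset.sum_eq_zero fun j _ => ?_
  by_cases hj : j ∈ I
  · rw [← S.pairing, h3 j hj, zero_mul]
  · rw [hc.2 j hj, mul_zero]

theorem star_pos {μ : V} (hμ : μ ∈ S.chamber) {I : Set (Fin m)} {c : Fin m → ℝ} (hc : PosOn I c)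
    {i : Fin m} (hiI : i ∉ I) (hi : i ∉ S.starSet μ I) : 0 < S.coroot i μ - S.L c i := by
  by_contra! h
  have h1 := S.L_nonpos hc.nonneg (hc.2 i hiI)
  have h2 := hμ i
  refine hi ⟨by linarith, hiI, fun j hj => ?_⟩
  by_contra hA
  rw [S.pairing] at hA
  have := S.zero_spread hc.nonneg (hc.2 i hiI) (by linarith) (j := j) (by exact_mod_cast hA)
  exact (hc.1 j hj).ne' this

theorem small_eps {ι : Type*} [Finite ι] (a b : ι → ℝ) :
    ∃ ε : ℝ, 0 < ε ∧ ∀ k, 0 < a k → ε * b k < a k := by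
  have h : ∀ᶠ ε : ℝ in nhdsWithin 0 (Ioi 0), ∀ k, 0 < a k → ε * b k < a k := by
    rw [Filter.eventually_all]
    intro k
    by_cases hk : 0 < a k
    · have : Filter.Tendsto (fun ε : ℝ => ε * b k) (nhdsWithin 0 (Ioi 0)) (nhds 0) := by
        have : Filter.Tendsto (fun ε : ℝ => ε * b k) (nhds 0) (nhds (0 * b k)) :=
          (continuous_id.mul continuous_const).tendsto 0
        rw [zero_mul] at this
        exact this.mono_left nhdsWithin_le_nhds
      filter_upwards [this.eventually (gt_mem_nhds hk)] with ε hε _ using hε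
    · exact Filter.Eventually.of_forall fun _ h => absurd h hk
  obtain ⟨ε, h1, h2⟩ := (h.and self_mem_nhdsWithin).exists
  exact ⟨ε, h2, h1⟩

theorem exists_pos {μ : V} (hμ : μ ∈ S.chamber) {I : Set (Fin m)} (hcon : S.MuConnected μ I)
    {If : Set (Fin m)} (hIf : If ⊆ I) (hfin : S.FinTypeComponents If) :
    ∃ c, PosOn I c ∧ (∀ i ∈ If, S.L c i = S.coroot i μ) ∧
      ∀ i ∈ I, i ∉ If → S.L c i < S.coroot i μ := by
  classical
  set P : (Fin m → ℝ) → Prop := fun c => (∀ i, 0 ≤ c i) ∧ (∀ i, i ∉ I → c i = 0) ∧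
    (∀ i ∈ If, S.L c i = S.coroot i μ) ∧ ∀ i ∈ I, i ∉ If → 0 < c i → S.L c i < S.coroot i μ with hP
  set supp : (Fin m → ℝ) → Finset (Fin m) := fun c => Finset.univ.filter (fun i => 0 < c i) with hsupp
  obtain ⟨T, ⟨c, hc, rfl⟩, hmax⟩ := Set.exists_max_image (supp '' {c | P c}) Finset.card
    (Set.toFinite _) (by
      obtain ⟨c, h1, h2, h3⟩ := S.solve_comp hfin (fun i => S.coroot i μ) hμ
      exact ⟨_, c, ⟨h1, fun i hi => h2 i (fun h => hi (hIf h)), h3,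
        fun i _ hi h => absurd (h2 i hi) h.ne'⟩, rfl⟩)
  obtain ⟨c0, cI, cIf, cpos⟩ := hc
  have claim : ∀ i ∈ I, i ∉ If → c i = 0 → S.coroot i μ ≤ S.L c i := by
    intro i hi hiIf hci
    by_contra! hlt
    obtain ⟨h, h1, h2, h3⟩ := S.solve_comp hfin (fun k => |(S.A k i : ℝ)|) (fun _ => abs_nonneg _)
    set v : Fin m → ℝ := Pi.single i 1 + h with hv
    have hv0 : ∀ k, 0 ≤ v k := by
      intro k
      refine add_nonneg ?_ (h1 k)
      by_cases hk : k = i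
      · subst hk; simp
      · simp [hk]
    have hLv : ∀ k, S.L v k = S.A k i + S.L h k := by
      intro k
      rw [hv, L_add]
      congr 1
      unfold L
      rw [Finset.sum_eq_single i]
      · simp
      · intro b _ hb; simp [hb]
      · simp
    have hLvIf : ∀ k ∈ If, S.L v k = 0 := by
      intro k hk
      have hki : k ≠ i := by rintro rfl; exact hiIf hk
      rw [hLv, h3 k hk, abs_of_nonpos (S.off_nonpos hki)]; ring
    obtain ⟨ε, hε, hε2⟩ := small_eps (fun k => S.coroot k μ - S.L c k) (fun k => S.L v k)
    have hvk : ∀ k, k ∉ If → k ≠ i → v k = 0 := fun k hk hki => by simp [hv, hki, h2 k hk]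
    have hP' : P (c + ε • v) := by
      refine ⟨fun k => add_nonneg (c0 k) (mul_nonneg hε.le (hv0 k)), ?_, ?_, ?_⟩
      · intro k hk
        have hki : k ≠ i := by rintro rfl; exact hk hi
        simp [cI k hk, hvk k (fun h => hk (hIf h)) hki]
      · intro k hk
        rw [L_add, L_smul, cIf k hk, hLvIf k hk]; ring
      · intro k hk hkIf hpos
        have : 0 < S.coroot k μ - S.L c k := by
          by_cases hki : k = i
          · subst hki; linarith
          · have : 0 < c k := by simpa [hvk k hkIf hki] using hpos
            linarith [cpos k hk hkIf this]
        have := hε2 k this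
        rw [L_add, L_smul]; linarith
    have hlt' : supp c ⊂ supp (c + ε • v) := by
      rw [Finset.ssubset_iff_of_subset]
      · refine ⟨i, ?_, ?_⟩
        · simp only [hsupp, Finset.mem_filter, Finset.mem_univ, true_and]
          have h7 : v i = 1 := by simp [hv, h2 i hiIf]
          simp [hci, h7, hε]
        · simp [hsupp, hci]
      · intro k hk
        simp only [hsupp, Finset.mem_filter, Finset.mem_univ, true_and] at hk ⊢
        exact add_pos_of_pos_of_nonneg hk (mul_nonneg hε.le (hv0 k))
    have h8 := hmax _ ⟨_, hP', rfl⟩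
    have h9 := Finset.card_lt_card hlt'
    omega
  have claim' : ∀ i ∈ I, c i = 0 → S.coroot i μ ≤ S.L c i := by
    intro i hi hci
    by_cases hiIf : i ∈ If
    · exact (cIf i hiIf).ge
    · exact claim i hi hiIf hci
  have hc : ∀ i ∈ I, 0 < c i := by
    by_contra! hne
    obtain ⟨i0, hi0, hi0'⟩ := hne
    obtain ⟨i, ⟨hi, hi'⟩, hpos⟩ := S.mu_closed hcon hμ {i ∈ I | c i = 0} (fun i hi => hi.1)
      ⟨i0, hi0, le_antisymm hi0' (c0 i0)⟩ (by
        rintro i ⟨hi, hi'⟩ j hj hA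
        exact ⟨hj, S.zero_spread c0 hi' ((hμ i).trans (claim' i hi hi')) hA⟩)
    have := claim' i hi hi'
    have := S.L_nonpos c0 hi'
    linarith
  exact ⟨c, ⟨hc, cI⟩, cIf, fun i hi hiIf => cpos i hi hiIf (hc i hi)⟩

theorem part5 {μ : V} (hμ : μ ∈ S.chamber) {I : Set (Fin m)} (hcon : S.MuConnected μ I)
    {If : Set (Fin m)} (hIf : If ⊆ I) (hfin : S.FinTypeComponents If) :
    (((fun v => μ - v) '' S.conePos I) ∩ S.openFacet (S.starSet μ I ∪ If)).Nonempty := by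
  obtain ⟨c, hc, h1, h2⟩ := S.exists_pos hμ hcon hIf hfin
  refine ⟨_, ⟨_, ⟨c, hc.1, hc.2, rfl⟩, rfl⟩, ?_, ?_⟩
  · rintro i (hi | hi)
    · simp only [coroot_sub_sum]; exact S.star_zero hc hi
    · simp only [coroot_sub_sum]; rw [h1 i hi, sub_self]
  · intro i hi
    simp only [coroot_sub_sum]
    rw [mem_union, not_or] at hi
    by_cases hiI : i ∈ I
    · linarith [h2 i hiI hi.2]
    · exact S.star_pos hμ hc hiI hi.1

theorem part4 {μ : V} {I : Set (Fin m)} {If If' : Set (Fin m)} (hIf : If ⊆ I) (hIf' : If' ⊆ I)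
    (hne : If ≠ If') :
    Disjoint (((fun v => μ - v) '' S.conePos I) ∩ S.openFacet (S.starSet μ I ∪ If))
        (((fun v => μ - v) '' S.conePos I) ∩ S.openFacet (S.starSet μ I ∪ If')) := by
  rw [Set.disjoint_left]
  rintro x ⟨_, h1, h2⟩ ⟨_, h1', h2'⟩
  apply hne
  ext i
  constructor
  · intro hi
    by_contra hi'
    have := h2' i (by rintro (h | h); exacts [h.2.1 (hIf hi), hi' h])
    exact this.ne' (h1 i (Or.inr hi))
  · intro hi
    by_contra hi'
    have := h2 i (by rintro (h | h); exacts [h.2.1 (hIf' hi), hi' h])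
    exact this.ne' (h1' i (Or.inr hi))

theorem part3 {μ : V} (hμ : μ ∈ S.chamber) {I : Set (Fin m)} (hcon : S.MuConnected μ I) :
    ((fun v => μ - v) '' S.conePos I) ∩ S.chamber =
      ⋃ If ∈ {K : Set (Fin m) | K ⊆ I ∧ S.FinTypeComponents K},
        ((fun v => μ - v) '' S.conePos I) ∩ S.openFacet (S.starSet μ I ∪ If) := by
  ext x
  simp only [mem_iUnion, exists_prop]
  constructor
  · rintro ⟨⟨_, ⟨c, h1, h2, rfl⟩, rfl⟩, hx⟩
    have hc : PosOn I c := ⟨h1, h2⟩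
    have hx' : ∀ i, 0 ≤ S.coroot i μ - S.L c i := fun i => by
      rw [← coroot_sub_sum]; exact hx i
    obtain ⟨q, hq, hq'⟩ := S.strict_sub hμ hcon (K := {i ∈ I | S.coroot i μ - S.L c i = 0})
      (fun i hi => hi.1) hc (fun i hi => by have := hi.2; linarith)
    refine ⟨{i ∈ I | S.coroot i μ - S.L c i = 0}, ⟨fun i hi => hi.1,
      S.finTypeComponents_of (S.finiteType_of_pos _ q hq hq')⟩, ⟨_, ⟨c, h1, h2, rfl⟩, rfl⟩, ?_, ?_⟩
    · rintro i (hi | hi)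
      · simp only [coroot_sub_sum]; exact S.star_zero hc hi
      · simp only [coroot_sub_sum]; exact hi.2
    · intro i hi
      simp only [coroot_sub_sum]
      rw [mem_union, not_or] at hi
      by_cases hiI : i ∈ I
      · exact lt_of_le_of_ne (hx' i) fun h => hi.2 ⟨hiI, h.symm⟩
      · exact S.star_pos hμ hc hiI hi.1
  · rintro ⟨If, _, hx, h1, h2⟩
    refine ⟨hx, fun i => ?_⟩
    by_cases hi : i ∈ S.starSet μ I ∪ If
    · exact (h1 i hi).ge
    · exact (h2 i hi).le

end GCMRealization

namespace GCMRealization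
variable {m : ℕ} {V : Type*} [NormedAddCommGroup V] [NormedSpace ℝ V]
variable (S : GCMRealization m V)

theorem ri_extend {F : Set V} {x y : V} (hx : x ∈ intrinsicInterior ℝ F) (hy : y ∈ F) :
    ∃ ε : ℝ, 0 < ε ∧ x + ε • (x - y) ∈ F := by
  obtain ⟨z, hz, rfl⟩ := mem_intrinsicInterior.1 hx
  have hyA : y ∈ affineSpan ℝ F := subset_affineSpan ℝ F hy
  let f : ℝ → affineSpan ℝ F := fun ε =>
    ⟨ε • ((z : V) -ᵥ y) +ᵥ (z : V), AffineSubspace.smul_vsub_vadd_mem _ ε z.2 hyA z.2⟩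
  have hf : Continuous f := by
    apply Continuous.subtype_mk
    simp only [vsub_eq_sub, vadd_eq_add]
    fun_prop
  have hf0 : f 0 = z := by ext; simp [f]
  have h1 : ∀ᶠ ε in nhds (0 : ℝ), f ε ∈ interior ((↑) ⁻¹' F : Set (affineSpan ℝ F)) :=
    hf.continuousAt.eventually_mem (by rw [hf0]; exact isOpen_interior.mem_nhds hz)
  have h2 : ∀ᶠ ε in nhdsWithin (0 : ℝ) (Ioi 0),
      f ε ∈ interior ((↑) ⁻¹' F : Set (affineSpan ℝ F)) := h1.filter_mono nhdsWithin_le_nhds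
  obtain ⟨ε, h3, h4⟩ := (h2.and self_mem_nhdsWithin).exists
  refine ⟨ε, h4, ?_⟩
  have h5 := interior_subset h3
  simp only [mem_preimage, f, vsub_eq_sub, vadd_eq_add] at h5
  rwa [add_comm]

theorem cd_face {μ : V} (hμ : μ ∈ S.chamber) {I : Set (Fin m)} {y : V} (hy : y ∈ S.face μ I) :
    (∀ i, 0 ≤ S.cd (μ - y) i) ∧ (∀ i, i ∉ I → S.cd (μ - y) i = 0) ∧
      μ - y = ∑ i, S.cd (μ - y) i • S.root i := by
  obtain ⟨c, h1, h2, h3⟩ := S.face_sub_mem_cone hμ hy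
  have : S.cd (μ - y) = c := by rw [h3, cd_sum]
  rw [this]
  exact ⟨h1, h2, h3⟩

theorem part2_sub {μ : V} (hμ : μ ∈ S.chamber) {I : Set (Fin m)} (hcon : S.MuConnected μ I) {x : V}
    (hx : x ∈ intrinsicInterior ℝ (S.face μ I)) : x ∈ (fun v => μ - v) '' S.conePos I := by
  obtain ⟨h0, hI, hsum⟩ := S.cd_face hμ (intrinsicInterior_subset hx)
  refine ⟨μ - x, ⟨S.cd (μ - x), ?_, hI, hsum⟩, by simp⟩
  by_contra! hne
  obtain ⟨i0, hi0, hle⟩ := hne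
  have hz : ∀ y ∈ S.face μ I, S.cd (μ - y) i0 = 0 := by
    intro y hy
    obtain ⟨ε, hε, hmem⟩ := ri_extend hx hy
    have h1 := (S.cd_face hμ hmem).1 i0
    have e : μ - (x + ε • (x - y)) = (1 + ε) • (μ - x) - ε • (μ - y) := by module
    rw [e, map_sub, map_smul, map_smul] at h1
    simp only [Pi.sub_apply, Pi.smul_apply, smul_eq_mul] at h1
    have h2 := (S.cd_face hμ hy).1 i0
    have h3 := le_antisymm hle (h0 i0)
    rw [h3, mul_zero, zero_sub] at h1
    nlinarith
  have hs : ∀ i ∈ I, (∀ y ∈ S.face μ I, S.cd (μ - y) i = 0) → ∀ y ∈ S.face μ I, S.coroot i y = 0 := by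
    intro i hi h y hy
    have h1 := h _ (S.mem_face_of_mem (S.s_mem_WI hi) hy)
    have e : μ - S.s i y = (μ - y) + S.coroot i y • S.root i := by rw [s_apply]; abel
    rw [e, map_add, map_smul, cd_root] at h1
    rw [Pi.add_apply, h y hy] at h1
    simpa using h1
  obtain ⟨i, ⟨hi, hi'⟩, hpos⟩ := S.mu_closed hcon hμ
    {i ∈ I | ∀ y ∈ S.face μ I, S.cd (μ - y) i = 0} (fun i hi => hi.1) ⟨i0, hi0, hz⟩ (by
      rintro i ⟨hi, hi'⟩ j hj hA
      refine ⟨hj, fun y hy => ?_⟩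
      obtain ⟨g1, g2, g3⟩ := S.cd_face hμ hy
      refine S.zero_spread g1 (hi' y hy) ?_ hA
      rw [← coroot_sum, ← g3, map_sub, hs i hi hi' y hy, sub_zero]
      exact hμ i)
  exact hpos.ne' (hs i hi hi' μ (S.mu_mem_face μ I))

/-- Extension by zero. -/
noncomputable def ex (I : Set (Fin m)) : (I → ℝ) →ₗ[ℝ] (Fin m → ℝ) :=
  Function.ExtendByZero.linearMap ℝ Subtype.val

theorem ex_coe (I : Set (Fin m)) (k : I → ℝ) (i : I) : ex I k i = k i := by
  simp [ex]

theorem ex_off (I : Set (Fin m)) (k : I → ℝ) {i : Fin m} (hi : i ∉ I) : ex I k i = 0 := by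
  simp only [ex, Function.ExtendByZero.linearMap_apply]
  rw [Function.extend_apply']
  · rfl
  · rintro ⟨a, rfl⟩; exact hi a.2

theorem ex_restrict (I : Set (Fin m)) (c : Fin m → ℝ) (hc : ∀ i, i ∉ I → c i = 0) :
    ex I (fun i => c i) = c := by
  funext i
  by_cases hi : i ∈ I
  · exact ex_coe I (fun i => c i) ⟨i, hi⟩
  · rw [ex_off I _ hi, hc i hi]

theorem ex_single [DecidableEq (Fin m)] (I : Set (Fin m)) (i : I) (t : ℝ) :
    ex I (Pi.single i t) = Pi.single (i : Fin m) t := by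
  funext j
  by_cases hj : j ∈ I
  · rw [ex_coe I _ ⟨j, hj⟩]
    by_cases hij : j = i
    · subst hij; simp
    · have : (⟨j, hj⟩ : I) ≠ i := fun h => hij (by rw [← h])
      simp [this, hij]
  · have : j ≠ i := by rintro rfl; exact hj i.2
    rw [ex_off I _ hj]; simp [this]

/-- The affine parametrization `k ↦ μ - ∑ k_i α_i`. -/
noncomputable def phi (μ : V) (I : Set (Fin m)) : (I → ℝ) →ᵃ[ℝ] V :=
  AffineMap.const ℝ _ μ - (Fintype.linearCombination ℝ S.root ∘ₗ ex I).toAffineMap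

theorem phi_apply (μ : V) (I : Set (Fin m)) (k : I → ℝ) :
    S.phi μ I k = μ - ∑ i, ex I k i • S.root i := by
  simp [phi, Fintype.linearCombination_apply]

/-- The face in coordinates. -/
def Fp (μ : V) (I : Set (Fin m)) : Set (I → ℝ) := S.phi μ I ⁻¹' S.face μ I

theorem Fp_convex (μ : V) (I : Set (Fin m)) : Convex ℝ (S.Fp μ I) :=
  (convex_convexHull ℝ _).affine_preimage _

theorem Fp_zero (μ : V) (I : Set (Fin m)) : (0 : I → ℝ) ∈ S.Fp μ I := by
  change S.phi μ I 0 ∈ S.face μ I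
  rw [phi_apply]
  simpa using S.mu_mem_face μ I

theorem Fp_nonneg {μ : V} (hμ : μ ∈ S.chamber) {I : Set (Fin m)} {k : I → ℝ} (hk : k ∈ S.Fp μ I)
    (i : I) : 0 ≤ k i := by
  have := (S.cd_face hμ (show S.phi μ I k ∈ S.face μ I from hk)).1 i
  rwa [phi_apply, sub_sub_cancel, cd_sum, ex_coe] at this

open Classical in
/-- The reflections in coordinates. -/
noncomputable def sg (μ : V) (I : Set (Fin m)) (i : I) (k : I → ℝ) : I → ℝ :=
  k + Pi.single i (S.coroot i (S.phi μ I k))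

theorem phi_sg (μ : V) (I : Set (Fin m)) (i : I) (k : I → ℝ) :
    S.phi μ I (S.sg μ I i k) = S.s i (S.phi μ I k) := by
  classical
  rw [s_apply, phi_apply, sg, map_add]
  have h := ex_single I i (S.coroot i (S.phi μ I k))
  have h' : ex I (Pi.single i (S.coroot i (S.phi μ I k))) =
    Pi.single (i : Fin m) (S.coroot i (S.phi μ I k)) := h
  simp only [Pi.add_apply, add_smul, Finset.sum_add_distrib]
  have h2 : ∑ j, (ex I (Pi.single i (S.coroot i (S.phi μ I k)))) j • S.root j =
      S.coroot i (S.phi μ I k) • S.root i := by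
    rw [h', Finset.sum_eq_single (i : Fin m)]
    · simp
    · intro b _ hb; simp [hb]
    · simp
  rw [show S.phi μ I k - S.coroot i (S.phi μ I k) • S.root i =
    μ - ∑ j, ex I k j • S.root j - S.coroot i (S.phi μ I k) • S.root i by rw [← phi_apply], ← h2]
  rw [sub_sub]

theorem phi_inj (μ : V) (I : Set (Fin m)) : Function.Injective (S.phi μ I) := by
  intro k k' h
  rw [phi_apply, phi_apply, sub_right_inj] at h
  have h2 := congrArg S.cd h
  rw [cd_sum, cd_sum] at h2
  funext i
  rw [← ex_coe I k, ← ex_coe I k', h2]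

theorem sg_sg (μ : V) (I : Set (Fin m)) (i : I) (k : I → ℝ) :
    S.sg μ I i (S.sg μ I i k) = k := by
  apply S.phi_inj μ I
  rw [phi_sg, phi_sg, s_s_apply]

theorem phi_cont (μ : V) (I : Set (Fin m)) : Continuous (S.phi μ I) :=
  continuous_const.sub (LinearMap.continuous_of_finiteDimensional
    (Fintype.linearCombination ℝ S.root ∘ₗ ex I))

theorem coroot_cont (i : Fin m) : Continuous (S.coroot i) :=
  have := S.finDim
  LinearMap.continuous_of_finiteDimensional _

theorem sg_cont (μ : V) (I : Set (Fin m)) (i : I) : Continuous (S.sg μ I i) := by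
  classical
  unfold sg
  refine continuous_id.add ?_
  exact (continuous_single (A := fun _ : I => ℝ) i).comp
    ((S.coroot_cont i).comp (S.phi_cont μ I))

theorem sg_mem {μ : V} {I : Set (Fin m)} (i : I) {k : I → ℝ} (hk : k ∈ S.Fp μ I) :
    S.sg μ I i k ∈ S.Fp μ I := by
  change S.phi μ I _ ∈ S.face μ I
  rw [phi_sg]
  exact S.mem_face_of_mem (S.s_mem_WI i.2) hk

theorem sg_mem_closure {μ : V} {I : Set (Fin m)} (i : I) {k : I → ℝ}
    (hk : k ∈ closure (S.Fp μ I)) : S.sg μ I i k ∈ closure (S.Fp μ I) :=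
  map_mem_closure (S.sg_cont μ I i) hk fun _ h => S.sg_mem i h

theorem sg_mem_interior {μ : V} {I : Set (Fin m)} (i : I) {k : I → ℝ}
    (hk : k ∈ interior (S.Fp μ I)) : S.sg μ I i k ∈ interior (S.Fp μ I) := by
  rw [mem_interior]
  refine ⟨S.sg μ I i ⁻¹' interior (S.Fp μ I), ?_, isOpen_interior.preimage (S.sg_cont μ I i), ?_⟩
  · intro k' hk'
    rw [← S.sg_sg μ I i k']
    exact S.sg_mem i (interior_subset hk')
  · rw [mem_preimage, sg_sg]; exact hk

theorem coroot_phi (μ : V) (I : Set (Fin m)) (k : I → ℝ) (i : Fin m) :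
    S.coroot i (S.phi μ I k) = S.coroot i μ - S.L (ex I k) i := by
  rw [phi_apply, coroot_sub_sum]

end GCMRealization

namespace GCMRealization
variable {m : ℕ} {V : Type*} [NormedAddCommGroup V] [NormedSpace ℝ V]
variable (S : GCMRealization m V)

theorem ex_posOn {I : Set (Fin m)} {k : I → ℝ} (hk : ∀ i, 0 < k i) : PosOn I (ex I k) :=
  ⟨fun i hi => by rw [ex_coe I k ⟨i, hi⟩]; exact hk _, fun i hi => ex_off I k hi⟩

theorem ex_nonneg {I : Set (Fin m)} {k : I → ℝ} (hk : ∀ i, 0 ≤ k i) (i : Fin m) : 0 ≤ ex I k i := by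
  by_cases hi : i ∈ I
  · rw [ex_coe I k ⟨i, hi⟩]; exact hk _
  · rw [ex_off I k hi]

theorem mem_closure_Fp {μ : V} (hμ : μ ∈ S.chamber) {I : Set (Fin m)} (hcon : S.MuConnected μ I)
    (c : I → ℝ) (hc : ∀ i, 0 < c i) (hdom : ∀ i : I, 0 ≤ S.coroot i (S.phi μ I c)) :
    c ∈ closure (S.Fp μ I) := by
  classical
  have hcomp : IsCompact (closure (S.Fp μ I) ∩ Icc 0 c) := isCompact_Icc.inter_left isClosed_closure
  obtain ⟨k, ⟨hkG, hk0, hkc⟩, hmax⟩ := hcomp.exists_isMaxOn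
    ⟨0, subset_closure (S.Fp_zero μ I), le_rfl, fun i => (hc i).le⟩
    (f := fun k : I → ℝ => ∑ i, k i) (by fun_prop)
  have hconv : Convex ℝ (closure (S.Fp μ I)) := (S.Fp_convex μ I).closure
  have hT : ∀ i : I, k i < c i → S.coroot i (S.phi μ I k) ≤ 0 := by
    intro i hi
    by_contra! hpos
    set t := S.coroot i (S.phi μ I k) with ht
    obtain ⟨ε, hε, hε1, hε2⟩ : ∃ ε : ℝ, 0 < ε ∧ ε ≤ 1 ∧ ε * t ≤ c i - k i := by
      refine ⟨min 1 ((c i - k i) / t), lt_min one_pos (div_pos (by linarith) hpos),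
        min_le_left _ _, ?_⟩
      calc min 1 ((c i - k i) / t) * t ≤ ((c i - k i) / t) * t :=
            mul_le_mul_of_nonneg_right (min_le_right _ _) hpos.le
        _ = c i - k i := by field_simp
    have hmem : k + Pi.single i (ε * t) ∈ closure (S.Fp μ I) := by
      have h1 := hconv hkG (S.sg_mem_closure i hkG) (sub_nonneg.2 hε1) hε.le (by ring)
      convert h1 using 1
      funext j
      simp only [sg, Pi.add_apply, Pi.smul_apply, smul_eq_mul]
      by_cases hj : j = i
      · subst hj; simp only [Pi.single_eq_same]; rw [← ht]; ring
      · simp only [Pi.single_eq_of_ne hj]; ring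
    have hle := hmax (show k + Pi.single i (ε * t) ∈ closure (S.Fp μ I) ∩ Icc 0 c from
      ⟨hmem, fun j => by
        have := hk0 j
        by_cases hj : j = i
        · subst hj
          have h3 := mul_pos hε hpos
          simp only [Pi.zero_apply, Pi.add_apply, Pi.single_eq_same] at this ⊢
          linarith
        · simpa [hj] using this, fun j => by
        have := hkc j
        by_cases hj : j = i
        · subst hj
          simp only [Pi.add_apply, Pi.single_eq_same]
          linarith
        · simpa [hj] using this⟩)
    simp only [mem_ofPred_eq, Pi.add_apply, Finset.sum_add_distrib, Finset.sum_pi_single',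
      Finset.mem_univ, if_true] at hle
    have := mul_pos hε hpos
    have h9 : ∑ x : I, (Pi.single i (ε * t) : I → ℝ) x = ε * t := by simp
    linarith
  have hkn : ∀ i, 0 ≤ k i := fun i => hk0 i
  have hkpos : ∀ i : I, 0 < k i := by
    by_contra! hne
    obtain ⟨i0, hi0⟩ := hne
    have hle : ∀ i ∈ {i ∈ I | ex I k i = 0}, S.coroot i μ ≤ S.L (ex I k) i := by
      rintro i ⟨hi, hi'⟩
      have h1 := hT ⟨i, hi⟩ (by rw [← ex_coe I k ⟨i, hi⟩, hi']; exact hc _)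
      rw [coroot_phi] at h1
      simpa using h1
    obtain ⟨i, hi, hpos⟩ := S.mu_closed hcon hμ {i ∈ I | ex I k i = 0} (fun i hi => hi.1)
      ⟨i0, i0.2, by rw [ex_coe]; exact le_antisymm hi0 (hkn i0)⟩ (by
        intro i hi j hj hA
        exact ⟨hj, S.zero_spread (ex_nonneg hkn) hi.2 ((hμ i).trans (hle i hi)) hA⟩)
    have h1 := hle i hi
    have h2 := S.L_nonpos (ex_nonneg hkn) hi.2
    linarith
  set T : Set (Fin m) := {i ∈ I | ex I k i < ex I c i} with hTdef
  have hTle : ∀ i ∈ T, S.coroot i μ ≤ S.L (ex I k) i := by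
    rintro i ⟨hi, hi'⟩
    have h1 := hT ⟨i, hi⟩ (by rw [← ex_coe I k ⟨i, hi⟩, ← ex_coe I c ⟨i, hi⟩]; exact hi')
    rw [coroot_phi] at h1
    simpa using h1
  obtain ⟨q, hq, hq'⟩ := S.strict_sub hμ hcon (K := T) (fun i hi => hi.1) (ex_posOn hkpos) hTle
  have hfin := S.fin_compare T q hq hq' (ex I c - ex I k) (by
      intro i hi
      by_cases hiI : i ∈ I
      · have h1 : ¬ ex I k i < ex I c i := fun h => hi ⟨hiI, h⟩
        have h2 : ex I k i ≤ ex I c i := by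
          rw [ex_coe I k ⟨i, hiI⟩, ex_coe I c ⟨i, hiI⟩]; exact hkc _
        rw [Pi.sub_apply]; linarith
      · rw [Pi.sub_apply, ex_off I c hiI, ex_off I k hiI, sub_zero]) (by
      intro i hi _
      rw [L_subv]
      have h1 := hTle i hi
      have h2 := hdom ⟨i, hi.1⟩
      rw [coroot_phi] at h2
      simp only at h2
      linarith)
  have hck : c = k := by
    funext i
    have h1 := hfin i
    rw [Pi.sub_apply, ex_coe, ex_coe] at h1
    have h2 := hkc i
    linarith
  rw [hck]; exact hkG

theorem affineSpan_Fp {μ : V} (hμ : μ ∈ S.chamber) {I : Set (Fin m)} (hcon : S.MuConnected μ I)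
    (c : I → ℝ) (hc : ∀ i, 0 < c i) (hdom : ∀ i : I, 0 < S.coroot i (S.phi μ I c)) :
    c ∈ interior (S.Fp μ I) := by
  classical
  set U : Set (I → ℝ) := {c | (∀ i, 0 < c i) ∧ ∀ i : I, 0 < S.coroot i (S.phi μ I c)} with hU
  have hUo : IsOpen U := by
    have e : U = (⋂ i : I, {c | 0 < c i}) ∩ ⋂ i : I, {c | 0 < S.coroot i (S.phi μ I c)} := by
      ext c; simp [hU]
    rw [e]
    refine (isOpen_iInter_of_finite fun i => ?_).inter (isOpen_iInter_of_finite fun i => ?_)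
    · exact isOpen_lt continuous_const (continuous_apply i)
    · exact isOpen_lt continuous_const ((S.coroot_cont i).comp (S.phi_cont μ I))
  have hcU : c ∈ U := ⟨hc, hdom⟩
  have hUG : U ⊆ closure (S.Fp μ I) := fun c hc =>
    S.mem_closure_Fp hμ hcon c hc.1 fun i => (hc.2 i).le
  have hspan : affineSpan ℝ (S.Fp μ I) = ⊤ := by
    have h1 : closure (S.Fp μ I) ⊆ (affineSpan ℝ (S.Fp μ I) : Set (I → ℝ)) :=
      closure_minimal (subset_affineSpan ℝ _) (AffineSubspace.closed_of_finiteDimensional _)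
    have h2 : affineSpan ℝ U ≤ affineSpan ℝ (S.Fp μ I) := affineSpan_le.2 (hUG.trans h1)
    rw [hUo.affineSpan_eq_top ⟨c, hcU⟩] at h2
    exact top_le_iff.1 h2
  have hne := (S.Fp_convex μ I).interior_nonempty_iff_affineSpan_eq_top.2 hspan
  rw [← (S.Fp_convex μ I).interior_closure_eq_interior_of_nonempty_interior hne]
  exact interior_maximal hUG hUo hcU

theorem phi_mem_ri {μ : V} (hμ : μ ∈ S.chamber) {I : Set (Fin m)} {k : I → ℝ}
    (hk : k ∈ interior (S.Fp μ I)) : S.phi μ I k ∈ intrinsicInterior ℝ (S.face μ I) := by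
  have := S.finDim
  set r : (Fin m → ℝ) →ₗ[ℝ] (I → ℝ) := LinearMap.funLeft ℝ ℝ Subtype.val with hr
  set Θ : V →ₗ[ℝ] V := Fintype.linearCombination ℝ S.root ∘ₗ ex I ∘ₗ r ∘ₗ S.cd with hΘ
  have hΘa : ∀ v, S.phi μ I (r (S.cd (μ - v))) = μ - Θ (μ - v) := by
    intro v; rw [phi_apply]; simp [hΘ, Fintype.linearCombination_apply]
  have hfix : ∀ v ∈ affineSpan ℝ (S.face μ I), Θ (μ - v) = μ - v := by
    intro v hv
    refine affineSpan_induction hv ?_ ?_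
    · intro x hx
      obtain ⟨h1, h2, h3⟩ := S.cd_face hμ hx
      have e := ex_restrict I (S.cd (μ - x)) h2
      have e2 : ex I (r (S.cd (μ - x))) = S.cd (μ - x) := e
      simp only [hΘ, LinearMap.comp_apply, e2, Fintype.linearCombination_apply]
      exact h3.symm
    · intro c u v w hu hv hw
      have e : μ - (c • (u -ᵥ v) +ᵥ w) = (μ - w) - c • ((μ - v) - (μ - u)) := by
        simp only [vsub_eq_sub, vadd_eq_add]; module
      rw [e, map_sub, map_smul, map_sub Θ (μ - v), hu, hv, hw]
  have hphik : r (S.cd (μ - S.phi μ I k)) = k := by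
    rw [phi_apply, sub_sub_cancel, cd_sum]
    funext i
    exact ex_coe I k i
  rw [mem_intrinsicInterior]
  refine ⟨⟨S.phi μ I k, subset_affineSpan ℝ _ (interior_subset (s := S.Fp μ I) hk)⟩, ?_, rfl⟩
  rw [mem_interior]
  refine ⟨{z | r (S.cd (μ - (z : V))) ∈ interior (S.Fp μ I)}, ?_, ?_, ?_⟩
  · intro z hz
    have h1 : S.phi μ I (r (S.cd (μ - (z : V)))) ∈ S.face μ I :=
      interior_subset (s := S.Fp μ I) hz
    rw [hΘa, hfix z z.2, sub_sub_cancel] at h1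
    exact h1
  · apply isOpen_interior.preimage
    have h1 : Continuous (r ∘ₗ S.cd) := LinearMap.continuous_of_finiteDimensional _
    exact h1.comp (continuous_const.sub continuous_subtype_val)
  · change r (S.cd (μ - S.phi μ I k)) ∈ interior (S.Fp μ I)
    rw [hphik]; exact hk

theorem wd_phi {μ : V} {I : Set (Fin m)} {k : I → ℝ} (hk : k ∈ interior (S.Fp μ I))
    {w : V ≃ₗ[ℝ] V} (hw : w ∈ S.WI I) : w (S.phi μ I k) ∈ S.phi μ I '' interior (S.Fp μ I) := by
  obtain ⟨l, hl, rfl⟩ := S.exists_word hw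
  clear hw
  induction l with
  | nil => exact ⟨k, hk, rfl⟩
  | cons a l ih =>
    obtain ⟨k', h1, h2⟩ := ih fun j hj => hl j (by simp [hj])
    refine ⟨S.sg μ I ⟨a, hl a (by simp)⟩ k', S.sg_mem_interior _ h1, ?_⟩
    rw [phi_sg, h2, wd_cons, LinearEquiv.mul_apply]

theorem avg_zero {K : Set (Fin m)} (hfin : S.FiniteType K) {q : Fin m → ℝ} (hq : PosOn K q)
    (hq' : ∀ i ∈ K, 0 < S.L q i) : ∑ w ∈ S.elts hfin, w (∑ i, q i • S.root i) = 0 := by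
  set v := ∑ i, q i • S.root i with hv
  have h1 : ∑ w ∈ S.elts hfin, (v - w v) ∈ S.coneNonneg K := by
    refine Finset.sum_induction _ (· ∈ S.coneNonneg K) (fun _ _ => S.cone_add) (S.cone_zero K) ?_
    intro w hw
    exact S.sub_mem_cone (fun i hi => by rw [hv, coroot_sum]; exact (hq' i hi).le)
      ((S.mem_elts hfin w).1 hw)
  obtain ⟨c, -, hc2, hc3⟩ := h1
  set N : ℝ := ((S.elts hfin).card : ℝ)
  have h2 : ∑ w ∈ S.elts hfin, w v = ∑ i, (N • q - c) i • S.root i := by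
    rw [Finset.sum_sub_distrib, Finset.sum_const, ← Nat.cast_smul_eq_nsmul ℝ] at hc3
    simp only [Pi.sub_apply, sub_smul, Finset.sum_sub_distrib, ← hc3, Pi.smul_apply, smul_eq_mul,
      mul_smul, ← Finset.smul_sum, ← hv]
    simp only [N]
    abel
  have h3 := S.fin_inj K q hq hq' (N • q - c) (fun i hi => by simp [hc2 i hi, hq.2 i hi]) (by
    intro i hi
    rw [← coroot_sum, ← h2]
    exact S.avg_coroot hfin hi v)
  rw [h2, h3]; simp

theorem part2_sup {μ : V} (hμ : μ ∈ S.chamber) {I : Set (Fin m)} (hcon : S.MuConnected μ I) {x : V}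
    (hx : x ∈ (fun v => μ - v) '' S.conePos I) (hxC : x ∈ S.chamber) :
    x ∈ intrinsicInterior ℝ (S.face μ I) := by
  obtain ⟨_, ⟨c, h1, h2, rfl⟩, rfl⟩ := hx
  have hc : PosOn I c := ⟨h1, h2⟩
  simp only at hxC ⊢
  set x := μ - ∑ i, c i • S.root i with hx
  have hx' : ∀ i, S.coroot i x = S.coroot i μ - S.L c i := fun i => S.coroot_sub_sum μ c i
  set K : Set (Fin m) := {i ∈ I | S.coroot i x = 0} with hK
  obtain ⟨q, hq, hq'⟩ := S.strict_sub hμ hcon (K := K) (fun i hi => hi.1) hc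
    (fun i hi => by have h3 := hi.2; rw [hx'] at h3; linarith)
  have hfin := S.finiteType_of_pos K q hq hq'
  obtain ⟨δ, hδ, hδ2⟩ := small_eps (Sum.elim c (fun i => S.coroot i x))
    (Sum.elim q (fun i => - S.L q i))
  set c2 : Fin m → ℝ := c - δ • q with hc2
  have hc2off : ∀ i, i ∉ I → c2 i = 0 := fun i hi => by
    simp [hc2, h2 i hi, hq.2 i (fun h => hi h.1)]
  have hphi : S.phi μ I (fun i => c2 i) = x + δ • ∑ i, q i • S.root i := by
    rw [phi_apply, ex_restrict I c2 hc2off, hx]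
    simp only [hc2, Pi.sub_apply, Pi.smul_apply, sub_smul, Finset.sum_sub_distrib, smul_eq_mul,
      mul_smul, ← Finset.smul_sum]
    abel
  have hint : (fun i : I => c2 i) ∈ interior (S.Fp μ I) := by
    refine S.affineSpan_Fp hμ hcon _ (fun i => ?_) (fun i => ?_)
    · have := hδ2 (Sum.inl i) (h1 i i.2)
      simp only [Sum.elim_inl] at this
      simp [hc2, this]
    · rw [hphi, map_add, map_smul, coroot_sum, smul_eq_mul]
      rcases (hxC i).eq_or_lt with h | h
      · rw [← h, zero_add]
        exact mul_pos hδ (hq' i ⟨i.2, h.symm⟩)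
      · have := hδ2 (Sum.inr i) h
        simp only [Sum.elim_inr] at this
        linarith
  set N : ℝ := ((S.elts hfin).card : ℝ) with hN
  have hNpos : 0 < N := S.card_pos_toFinset hfin
  have hsum : ∑ w ∈ S.elts hfin, w (S.phi μ I (fun i => c2 i)) = N • x := by
    rw [hphi]
    simp only [map_add, map_smul, Finset.sum_add_distrib, ← Finset.smul_sum]
    rw [S.avg_zero hfin hq hq', smul_zero, add_zero]
    rw [Finset.sum_congr rfl (g := fun _ => x)
      (fun w hw => S.WI_fix ((S.mem_elts hfin w).1 hw) fun i hi => hi.2)]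
    rw [Finset.sum_const, hN, Nat.cast_smul_eq_nsmul]
  have hR : Convex ℝ (S.phi μ I '' interior (S.Fp μ I)) :=
    (S.Fp_convex μ I).interior.affine_image _
  have hmem := hR.sum_mem (t := S.elts hfin) (w := fun _ => N⁻¹)
    (z := fun w => w (S.phi μ I (fun i => c2 i))) (fun _ _ => (inv_pos.2 hNpos).le)
    (by rw [Finset.sum_const, nsmul_eq_mul, ← hN]; field_simp)
    (fun w hw => S.wd_phi hint (S.WI_mono (fun i hi => hi.1) ((S.mem_elts hfin w).1 hw)))
  rw [← Finset.smul_sum, hsum, smul_smul, inv_mul_cancel₀ hNpos.ne', one_smul] at hmem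
  obtain ⟨k, hk, hkx⟩ := hmem
  rw [← hkx]
  exact S.phi_mem_ri hμ hk

end GCMRealization

open GCMRealization in
theorem statement_6 {m : ℕ} {V : Type*} [NormedAddCommGroup V] [NormedSpace ℝ V]
    (S : GCMRealization m V) (μ : V) (hμ : μ ∈ S.chamber)
    (I : Set (Fin m)) (hcon : S.MuConnected μ I) :
    (intrinsicInterior ℝ (S.face μ I) =
      Set.image2 (fun (w : V ≃ₗ[ℝ] V) (x : V) => w x) (S.WI I : Set (V ≃ₗ[ℝ] V))
        (intrinsicInterior ℝ (S.face μ I) ∩ S.chamber)) ∧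
    (intrinsicInterior ℝ (S.face μ I) ∩ S.chamber =
      ((fun v => μ - v) '' S.conePos I) ∩ S.chamber) ∧
    (((fun v => μ - v) '' S.conePos I) ∩ S.chamber =
      ⋃ If ∈ {K : Set (Fin m) | K ⊆ I ∧ S.FinTypeComponents K},
        ((fun v => μ - v) '' S.conePos I) ∩ S.openFacet (S.starSet μ I ∪ If)) ∧
    (∀ If If' : Set (Fin m), If ⊆ I → S.FinTypeComponents If → If' ⊆ I →
      S.FinTypeComponents If' → If ≠ If' →
      Disjoint (((fun v => μ - v) '' S.conePos I) ∩ S.openFacet (S.starSet μ I ∪ If))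
        (((fun v => μ - v) '' S.conePos I) ∩ S.openFacet (S.starSet μ I ∪ If'))) ∧
    (∀ If : Set (Fin m), If ⊆ I → S.FinTypeComponents If →
      (((fun v => μ - v) '' S.conePos I) ∩ S.openFacet (S.starSet μ I ∪ If)).Nonempty) := by
  refine ⟨S.part1 hμ I, ?_, S.part3 hμ hcon, ?_, ?_⟩
  · ext x
    constructor
    · rintro ⟨h1, h2⟩
      exact ⟨S.part2_sub hμ hcon h1, h2⟩
    · rintro ⟨h1, h2⟩
      exact ⟨S.part2_sup hμ hcon h1 h2, h2⟩
  · intro If If' h1 _ h2 _ h3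
    exact S.part4 h1 h2 h3
  · intro If h1 h2
    exact S.part5 hμ hcon h1 h2
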